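/- arXiv:1810.07285 — 2 statements merged into one kernel-verified Lean document; each statement's English description precedes it below -/
import Mathlib

section
/- Let Σ be a finite alphabet and φ: Σ* → S a morphism to a finite monoid S. For every s ∈ S there exists an ε-free φ-good rational expression F_s over Σ with L(F_s) = φ⁻¹(s) \ {ε}. Consequently, G = ⋃_{s∈S} F_s is an unambiguous rational expression over Σ with L(G) = Σ⁺. -/
/-- Rational expressions: `∅ | ε | a | F∪F | F·F | F⁺`. -/
inductive RE (A : Type) where
  | zero : RE A
  | eps : RE A
  | char : A → RE A
  | union : RE A → RE A → RE A
  | cat : RE A → RE A → RE A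
  | plus : RE A → RE A

namespace RE

variable {A : Type}

/-- The language denoted by a rational expression. -/
def lang : RE A → Set (List A)
  | zero => ∅
  | eps => {[]}
  | char a => {[a]}
  | union e f => lang e ∪ lang f
  | cat e f => {w | ∃ u v, u ∈ lang e ∧ v ∈ lang f ∧ w = u ++ v}
  | plus e => {w | ∃ l : List (List A), l ≠ [] ∧ (∀ u ∈ l, u ∈ lang e) ∧ w = l.flatten}

/-- `ε` does not occur in the expression. -/
def epsFree : RE A → Prop
  | zero => True
  | eps => False
  | char _ => True
  | union e f => epsFree e ∧ epsFree f
  | cat e f => epsFree e ∧ epsFree f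
  | plus e => epsFree e

/-- Every denoted word has a unique parse: unions are disjoint, and
concatenation / Kleene-plus decompositions are unique. -/
def Unambiguous : RE A → Prop
  | zero => True
  | eps => True
  | char _ => True
  | union e f => Unambiguous e ∧ Unambiguous f ∧ lang e ∩ lang f = ∅
  | cat e f => Unambiguous e ∧ Unambiguous f ∧
      ∀ u v u' v', u ∈ lang e → v ∈ lang f → u' ∈ lang e → v' ∈ lang f →
        u ++ v = u' ++ v' → u = u' ∧ v = v'
  | plus e => Unambiguous e ∧
      ∀ l l' : List (List A), l ≠ [] → l' ≠ [] → (∀ u ∈ l, u ∈ lang e) →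
        (∀ u ∈ l', u ∈ lang e) → l.flatten = l'.flatten → l = l'

/-- The subexpression relation. -/
inductive Sub : RE A → RE A → Prop
  | refl (e : RE A) : Sub e e
  | unionL {e f g : RE A} : Sub e f → Sub e (union f g)
  | unionR {e f g : RE A} : Sub e g → Sub e (union f g)
  | catL {e f g : RE A} : Sub e f → Sub e (cat f g)
  | catR {e f g : RE A} : Sub e g → Sub e (cat f g)
  | plus {e f : RE A} : Sub e f → Sub e (plus f)

/-- `φ`-good expression: unambiguous, every subexpression maps to a single
semigroup element, and subexpressions under `⁺` map to an idempotent. -/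
def Good {S : Type} [Semigroup S] (φ : List A → S) (F : RE A) : Prop :=
  F.Unambiguous ∧
  (∀ E : RE A, Sub E F → ∃ s : S, ∀ w ∈ E.lang, φ w = s) ∧
  (∀ E : RE A, Sub (RE.plus E) F → ∃ s : S, s * s = s ∧ ∀ w ∈ E.lang, φ w = s)

end RE

namespace RE

/-- Concatenation of languages. -/
def catLang {A : Type} (L K : Set (List A)) : Set (List A) :=
  {w | ∃ u v, u ∈ L ∧ v ∈ K ∧ w = u ++ v}

/-- Kleene plus of a language. -/
def plusLang {A : Type} (L : Set (List A)) : Set (List A) :=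
  {w | ∃ l : List (List A), l ≠ [] ∧ (∀ u ∈ l, u ∈ L) ∧ w = l.flatten}

/-- Concatenation of `L` and `K` is unambiguous. -/
def UniqueCat {A : Type} (L K : Set (List A)) : Prop :=
  ∀ u v u' v', u ∈ L → v ∈ K → u' ∈ L → v' ∈ K → u ++ v = u' ++ v' → u = u' ∧ v = v'

/-- `P` freely generates the submonoid it spans. -/
def Code {A : Type} (P : Set (List A)) : Prop :=
  ∀ l l' : List (List A), (∀ u ∈ l, u ∈ P) → (∀ u ∈ l', u ∈ P) →
    l.flatten = l'.flatten → l = l'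

/-- Factorizations in `P* L` are unique. -/
def FreeLeft {A : Type} (P L : Set (List A)) : Prop :=
  ∀ l l' : List (List A), ∀ v v', (∀ u ∈ l, u ∈ P) → (∀ u ∈ l', u ∈ P) → v ∈ L → v' ∈ L →
    l.flatten ++ v = l'.flatten ++ v' → l = l' ∧ v = v'

/-- Factorizations in `L P*` are unique. -/
def FreeRight {A : Type} (L P : Set (List A)) : Prop :=
  ∀ l l' : List (List A), ∀ v v', (∀ u ∈ l, u ∈ P) → (∀ u ∈ l', u ∈ P) → v ∈ L → v' ∈ L →
    v ++ l.flatten = v' ++ l'.flatten → v = v' ∧ l = l'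

/-- No word of `P` is a proper prefix of another one. -/
def PrefixCode {A : Type} (P : Set (List A)) : Prop :=
  ∀ u ∈ P, ∀ u' ∈ P, ∀ v v', u ++ v = u' ++ v' → u = u'

/-- No word of `P` is a proper suffix of another one. -/
def SuffixCode {A : Type} (P : Set (List A)) : Prop :=
  ∀ u ∈ P, ∀ u' ∈ P, ∀ v v', v ++ u = v' ++ u' → u = u'

section Combinatorics

variable {A : Type} {P L : Set (List A)}

theorem PrefixCode.freeLeft (hP : PrefixCode P)
    (h : ∀ u ∈ P, ∀ x, ∀ v ∈ L, u ++ (x ++ v) ∉ L) : FreeLeft P L := by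
  intro l
  induction l with
  | nil =>
    intro l' v v' _ hl' hv hv' he
    cases l' with
    | nil => simpa using he
    | cons u l' =>
      exfalso
      refine h u (hl' u (by simp)) l'.flatten v' hv' ?_
      simp only [List.flatten_nil, List.nil_append, List.flatten_cons, List.append_assoc] at he
      rwa [← he]
  | cons u l ih =>
    intro l' v v' hl hl' hv hv' he
    cases l' with
    | nil =>
      exfalso
      refine h u (hl u (by simp)) l.flatten v hv ?_
      simp only [List.flatten_nil, List.nil_append, List.flatten_cons, List.append_assoc] at he
      rwa [he]
    | cons u' l' =>
      simp only [List.flatten_cons, List.append_assoc] at he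
      have hu := hP u (hl u (by simp)) u' (hl' u' (by simp)) _ _ he
      subst hu
      have := ih l' v v' (fun x hx => hl x (by simp [hx])) (fun x hx => hl' x (by simp [hx]))
        hv hv' (List.append_cancel_left he)
      simp [this]

theorem SuffixCode.freeRight (hP : SuffixCode P)
    (h : ∀ u ∈ P, ∀ x, ∀ v ∈ L, v ++ (x ++ u) ∉ L) : FreeRight L P := by
  have hP' : PrefixCode (List.reverse ⁻¹' P) := by
    intro u hu u' hu' v v' he
    have := hP _ hu _ hu' v.reverse v'.reverse (by simpa using congrArg List.reverse he)
    simpa using this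
  have hF : FreeLeft (List.reverse ⁻¹' P) (List.reverse ⁻¹' L) := by
    refine hP'.freeLeft fun u hu x v hv hmem => h _ hu x.reverse _ hv ?_
    simpa using hmem
  intro l l' v v' hl hl' hv hv' he
  have := hF (l.map List.reverse).reverse (l'.map List.reverse).reverse v.reverse v'.reverse
    (fun u hu => hl _ (by simpa using hu)) (fun u hu => hl' _ (by simpa using hu)) (by simpa using hv) (by simpa using hv')
    (by simpa [List.reverse_flatten] using congrArg List.reverse he)
  simp only [List.reverse_inj] at this
  exact ⟨this.2, List.map_injective_iff.2 List.reverse_injective this.1⟩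

theorem PrefixCode.code (hP : PrefixCode P) (hne : [] ∉ P) : Code P := by
  have hF : FreeLeft P {[]} := hP.freeLeft fun u hu x v _ he => by
    simp only [Set.mem_singleton_iff, List.append_eq_nil_iff] at he
    exact hne (he.1 ▸ hu)
  intro l l' hl hl' he
  exact (hF l l' [] [] hl hl' rfl rfl (by simpa using he)).1

theorem FreeRight.code (h : FreeRight L P) (hL : [] ∈ L) : Code P :=
  fun l l' hl hl' he => (h l l' [] [] hl hl' hL hL (by simpa using he)).2

theorem SuffixCode.uniqueCat (hP : SuffixCode P) (L : Set (List A)) : UniqueCat L P := by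
  intro u v u' v' _ hv _ hv' he
  have := hP v hv v' hv' u u' he
  subst this
  exact ⟨List.append_cancel_right he, rfl⟩

theorem PrefixCode.uniqueCat (hP : PrefixCode P) (L : Set (List A)) : UniqueCat P L := by
  intro u v u' v' hu _ hu' _ he
  have := hP u hu u' hu' v v' he
  subst this
  exact ⟨rfl, List.append_cancel_left he⟩

theorem SuffixCode.catLang (hP : SuffixCode P) (hL : SuffixCode L) :
    SuffixCode (catLang L P) := by
  rintro _ ⟨u, v, hu, hv, rfl⟩ _ ⟨u', v', hu', hv', rfl⟩ x x' he
  rw [← List.append_assoc, ← List.append_assoc] at he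
  have := hP v hv v' hv' _ _ he
  subst this
  rw [hL u hu u' hu' _ _ (List.append_cancel_right he)]

end Combinatorics

/-- The languages of good expressions, together with the value of their words. -/
inductive GoodLang {A S : Type} [Mul S] (ψ : A → S) : Set (List A) → S → Prop
  | zero (s : S) : GoodLang ψ ∅ s
  | char (a : A) : GoodLang ψ {[a]} (ψ a)
  | union {L K : Set (List A)} {s : S} : GoodLang ψ L s → GoodLang ψ K s → L ∩ K = ∅ →
      GoodLang ψ (L ∪ K) s
  | cat {L K : Set (List A)} {s t : S} : GoodLang ψ L s → GoodLang ψ K t → UniqueCat L K →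
      GoodLang ψ (catLang L K) (s * t)
  | plus {L : Set (List A)} {e : S} : GoodLang ψ L e → e * e = e → Code L →
      GoodLang ψ (plusLang L) e

section Values

variable {A S : Type} [Monoid S]

/-- The morphism extending `ψ` to words. -/
def val (ψ : A → S) (w : List A) : S := (w.map ψ).prod

@[simp] theorem val_nil (ψ : A → S) : val ψ [] = 1 := rfl

@[simp] theorem val_cons (ψ : A → S) (a : A) (w : List A) : val ψ (a :: w) = ψ a * val ψ w := by
  simp [val]

@[simp] theorem val_append (ψ : A → S) (u v : List A) :
    val ψ (u ++ v) = val ψ u * val ψ v := by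
  simp [val]

theorem val_id (l : List S) : val id l = l.prod := by
  simp [val]

theorem val_flatten (ψ : A → S) (l : List (List A)) :
    val ψ l.flatten = (l.map (val ψ)).prod := by
  induction l with
  | nil => simp
  | cons u l ih => simp [ih]

theorem val_mem {ψ : A → S} {R : Set S} (hR : ∀ x ∈ R, ∀ y ∈ R, x * y ∈ R) {w : List A}
    (hw : w ≠ []) (h : ∀ a ∈ w, ψ a ∈ R) : val ψ w ∈ R := by
  induction w with
  | nil => exact absurd rfl hw
  | cons a w ih =>
    rcases eq_or_ne w [] with rfl | hne
    · simpa using h a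
    · rw [val_cons]
      exact hR _ (h a (by simp)) _ (ih hne fun b hb => h b (by simp [hb]))

theorem val_flatten_of_idempotent {ψ : A → S} {L : Set (List A)} {e : S} (he : e * e = e)
    (hL : ∀ w ∈ L, val ψ w = e) {l : List (List A)} (hl : l ≠ []) (hlL : ∀ u ∈ l, u ∈ L) :
    val ψ l.flatten = e := by
  rw [val_flatten]
  have : val id (l.map (val ψ)) ∈ ({e} : Set S) := by
    refine val_mem (by simpa using he) (by simpa using hl) ?_
    simp only [List.mem_map, id_eq, Set.mem_singleton_iff, forall_exists_index, and_imp]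
    rintro _ u hu rfl
    exact hL u (hlL u hu)
  simpa [val] using this

theorem GoodLang.val_eq {ψ : A → S} {L : Set (List A)} {s : S} (h : GoodLang ψ L s) :
    ∀ w ∈ L, val ψ w = s := by
  induction h with
  | zero s => simp
  | char a => simp
  | union _ _ _ ih₁ ih₂ =>
    rintro w (hw | hw)
    exacts [ih₁ w hw, ih₂ w hw]
  | cat _ _ _ ih₁ ih₂ =>
    rintro _ ⟨u, v, hu, hv, rfl⟩
    rw [val_append, ih₁ u hu, ih₂ v hv]
  | plus _ he _ ih =>
    rintro _ ⟨l, hl, hlL, rfl⟩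
    exact val_flatten_of_idempotent he ih hl hlL

theorem GoodLang.exists_expr {ψ : A → S} {L : Set (List A)} {s : S} (h : GoodLang ψ L s) :
    ∃ F : RE A, F.epsFree ∧ F.Good (val ψ) ∧ F.lang = L := by
  induction h with
  | zero s =>
    refine ⟨.zero, trivial, ⟨trivial, ?_, ?_⟩, rfl⟩
    · rintro E hE
      cases hE
      exact ⟨s, fun w hw => hw.elim⟩
    · rintro E hE
      cases hE
  | char a =>
    refine ⟨.char a, trivial, ⟨trivial, ?_, ?_⟩, rfl⟩
    · rintro E hE
      cases hE
      exact ⟨ψ a, by simp [lang]⟩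
    · rintro E hE
      cases hE
  | @union L K s h₁ h₂ hd ih₁ ih₂ =>
    obtain ⟨F, hF, ⟨hF₁, hF₂, hF₃⟩, rfl⟩ := ih₁
    obtain ⟨G, hG, ⟨hG₁, hG₂, hG₃⟩, rfl⟩ := ih₂
    refine ⟨.union F G, ⟨hF, hG⟩, ⟨⟨hF₁, hG₁, hd⟩, ?_, ?_⟩, rfl⟩
    · intro E hE
      cases hE with
      | refl => exact ⟨s, (h₁.union h₂ hd).val_eq⟩
      | unionL h => exact hF₂ E h
      | unionR h => exact hG₂ E h
    · intro E hE
      cases hE with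
      | unionL h => exact hF₃ E h
      | unionR h => exact hG₃ E h
  | @cat L K s t h₁ h₂ hd ih₁ ih₂ =>
    obtain ⟨F, hF, ⟨hF₁, hF₂, hF₃⟩, rfl⟩ := ih₁
    obtain ⟨G, hG, ⟨hG₁, hG₂, hG₃⟩, rfl⟩ := ih₂
    refine ⟨.cat F G, ⟨hF, hG⟩, ⟨⟨hF₁, hG₁, hd⟩, ?_, ?_⟩, rfl⟩
    · intro E hE
      cases hE with
      | refl => exact ⟨s * t, (h₁.cat h₂ hd).val_eq⟩
      | catL h => exact hF₂ E h
      | catR h => exact hG₂ E h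
    · intro E hE
      cases hE with
      | catL h => exact hF₃ E h
      | catR h => exact hG₃ E h
  | @plus L e h he hc ih =>
    obtain ⟨F, hF, ⟨hF₁, hF₂, hF₃⟩, rfl⟩ := ih
    refine ⟨.plus F, hF, ⟨⟨hF₁, fun l l' _ _ => hc l l'⟩, ?_, ?_⟩, rfl⟩
    · intro E hE
      cases hE with
      | refl => exact ⟨e, (h.plus he hc).val_eq⟩
      | plus h => exact hF₂ E h
    · intro E hE
      cases hE with
      | refl => exact ⟨e, he, h.val_eq⟩
      | plus h => exact hF₃ E h

theorem GoodLang.biUnion {ψ : A → S} {κ : Type} (I : Finset κ) (f : κ → Set (List A)) {s : S}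
    (hf : ∀ i ∈ I, GoodLang ψ (f i) s)
    (hd : ∀ i ∈ I, ∀ j ∈ I, i ≠ j → f i ∩ f j = ∅) : GoodLang ψ (⋃ i ∈ I, f i) s := by
  classical
  induction I using Finset.induction_on with
  | empty => simpa using GoodLang.zero s
  | insert i I hi ih =>
    rw [Finset.set_biUnion_insert]
    refine (hf i (by simp)).union (ih (fun j hj => hf j (by simp [hj])) fun j hj k hk =>
      hd j (by simp [hj]) k (by simp [hk])) ?_
    rw [Set.inter_iUnion₂]
    simp only [Set.iUnion_eq_empty]
    intro j hj
    exact hd i (by simp) j (by simp [hj]) (by rintro rfl; exact hi hj)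

/-- Every fibre of `L` is denoted by a good expression. -/
def Nice (ψ : A → S) (L : Set (List A)) : Prop :=
  ∀ s, GoodLang ψ (L ∩ {w | val ψ w = s}) s

theorem Nice.empty (ψ : A → S) : Nice ψ ∅ := fun s => by simpa using GoodLang.zero s

theorem Nice.singleton (ψ : A → S) (a : A) : Nice ψ {[a]} := by
  intro s
  by_cases h : ψ a = s
  · subst h
    convert GoodLang.char (ψ := ψ) a using 1
    ext w
    simp +contextual
  · convert GoodLang.zero (ψ := ψ) s using 1
    ext w
    simp only [Set.mem_inter_iff, Set.mem_singleton_iff, Set.mem_ofPred_eq, Set.mem_empty_iff_false,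
      iff_false, not_and]
    rintro rfl
    simpa using h

theorem Nice.union {ψ : A → S} {L K : Set (List A)} (hL : Nice ψ L) (hK : Nice ψ K)
    (hd : ∀ w, w ∈ L → w ∉ K) : Nice ψ (L ∪ K) := by
  intro s
  rw [Set.union_inter_distrib_right]
  refine (hL s).union (hK s) ?_
  ext w
  simp only [Set.mem_inter_iff, Set.mem_empty_iff_false, iff_false]
  exact fun h => hd w h.1.1 h.2.1

theorem Nice.biUnion {ψ : A → S} {κ : Type} (I : Finset κ) (f : κ → Set (List A))
    (hf : ∀ i ∈ I, Nice ψ (f i))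
    (hd : ∀ i ∈ I, ∀ j ∈ I, i ≠ j → f i ∩ f j = ∅) : Nice ψ (⋃ i ∈ I, f i) := by
  intro s
  rw [Set.iUnion₂_inter]
  refine GoodLang.biUnion I _ (fun i hi => hf i hi s) fun i hi j hj hij => ?_
  rw [← Set.inter_inter_distrib_right, hd i hi j hj hij, Set.empty_inter]

theorem Nice.cat [Finite S] {ψ : A → S} {L K : Set (List A)} (hL : Nice ψ L) (hK : Nice ψ K)
    (hu : UniqueCat L K) : Nice ψ (catLang L K) := by
  classical
  have := Fintype.ofFinite S
  intro s
  have key : catLang L K ∩ {w | val ψ w = s} =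
      ⋃ p ∈ (Finset.univ.filter fun p : S × S => p.1 * p.2 = s),
        catLang (L ∩ {w | val ψ w = p.1}) (K ∩ {w | val ψ w = p.2}) := by
    ext w
    simp only [Set.mem_iUnion, Finset.mem_filter, Finset.mem_univ, true_and, exists_prop]
    constructor
    · rintro ⟨⟨u, v, hu, hv, rfl⟩, hs⟩
      exact ⟨(val ψ u, val ψ v), by simpa using hs, u, v, ⟨hu, rfl⟩, ⟨hv, rfl⟩, rfl⟩
    · rintro ⟨p, hp, u, v, ⟨hu, hu'⟩, ⟨hv, hv'⟩, rfl⟩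
      refine ⟨⟨u, v, hu, hv, rfl⟩, ?_⟩
      rw [Set.mem_ofPred_eq] at *
      rw [val_append, hu', hv', hp]
  rw [key]
  refine GoodLang.biUnion _ _ ?_ ?_
  · intro p hp
    rw [← (Finset.mem_filter.1 hp).2]
    exact (hL p.1).cat (hK p.2) fun u v u' v' h₁ h₂ h₃ h₄ => hu u v u' v' h₁.1 h₂.1 h₃.1 h₄.1
  · intro p _ q _ hpq
    ext w
    simp only [Set.mem_inter_iff, Set.mem_empty_iff_false, iff_false]
    rintro ⟨⟨u, v, hu₁, hv₁, rfl⟩, ⟨u', v', hu₂, hv₂, he⟩⟩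
    obtain ⟨rfl, rfl⟩ := hu u v u' v' hu₁.1 hv₁.1 hu₂.1 hv₂.1 he
    exact hpq (Prod.ext (hu₁.2.symm.trans hu₂.2) (hv₁.2.symm.trans hv₂.2))

theorem Nice.plus_of_idempotent {ψ : A → S} {P : Set (List A)} (hP : Nice ψ P) (hc : Code P)
    {e : S} (he : e * e = e) (hv : ∀ w ∈ P, val ψ w = e) : Nice ψ (plusLang P) := by
  have hPe : GoodLang ψ P e := by
    have := hP e
    rwa [show P ∩ {w | val ψ w = e} = P from Set.inter_eq_left.2 hv] at this
  have hplus := hPe.plus he hc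
  intro s
  by_cases hs : s = e
  · subst hs
    rwa [show plusLang P ∩ {w | val ψ w = s} = plusLang P from
      Set.inter_eq_left.2 hplus.val_eq]
  · convert GoodLang.zero (ψ := ψ) s using 1
    ext w
    simp only [Set.mem_inter_iff, Set.mem_ofPred_eq, Set.mem_empty_iff_false, iff_false, not_and]
    rintro hw rfl
    exact hs (hplus.val_eq w hw)

/-- The words whose `P`-factorization has its sequence of values in `X`. -/
def decode (ψ : A → S) (P : Set (List A)) (X : Set (List S)) : Set (List A) :=
  {w | ∃ l : List (List A), (∀ u ∈ l, u ∈ P) ∧ l.map (val ψ) ∈ X ∧ w = l.flatten}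

theorem GoodLang.decode {ψ : A → S} {P : Set (List A)} (hP : Nice ψ P) (hc : Code P)
    {X : Set (List S)} {s : S} (h : GoodLang id X s) : GoodLang ψ (decode ψ P X) s := by
  induction h with
  | zero s =>
    convert GoodLang.zero (ψ := ψ) s using 1
    ext w
    simp [RE.decode]
  | char a =>
    suffices RE.decode ψ P {[a]} = P ∩ {w | val ψ w = a} from this ▸ hP a
    ext w
    constructor
    · rintro ⟨l, hl, hla, rfl⟩
      obtain ⟨u, rfl, hu⟩ := List.map_eq_singleton_iff.1 hla
      simpa [hu] using hl
    · rintro ⟨hw, hwa⟩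
      exact ⟨[w], by simpa using hw, by simpa using hwa, by simp⟩
  | @union L K s _ _ hd ih₁ ih₂ =>
    convert ih₁.union ih₂ ?_ using 1
    · ext w
      constructor
      · rintro ⟨l, hl, hL | hK, rfl⟩
        exacts [.inl ⟨l, hl, hL, rfl⟩, .inr ⟨l, hl, hK, rfl⟩]
      · rintro (⟨l, hl, hL, rfl⟩ | ⟨l, hl, hL, rfl⟩)
        exacts [⟨l, hl, .inl hL, rfl⟩, ⟨l, hl, .inr hL, rfl⟩]
    · ext w
      simp only [Set.mem_inter_iff, Set.mem_empty_iff_false, iff_false]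
      rintro ⟨⟨l, hl, hL, rfl⟩, ⟨l', hl', hL', he⟩⟩
      obtain rfl := hc l l' hl hl' he
      exact (Set.ext_iff.1 hd _).1 ⟨hL, hL'⟩
  | @cat L K s t _ _ hu ih₁ ih₂ =>
    convert ih₁.cat ih₂ ?_ using 1
    · ext w
      constructor
      · rintro ⟨l, hl, ⟨u, v, hu, hv, he⟩, rfl⟩
        obtain ⟨l₁, l₂, rfl, rfl, rfl⟩ := List.map_eq_append_iff.1 he
        exact ⟨l₁.flatten, l₂.flatten, ⟨l₁, fun x hx => hl x (by simp [hx]), hu, rfl⟩,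
          ⟨l₂, fun x hx => hl x (by simp [hx]), hv, rfl⟩, by simp⟩
      · rintro ⟨_, _, ⟨l₁, hl₁, h₁, rfl⟩, ⟨l₂, hl₂, h₂, rfl⟩, rfl⟩
        refine ⟨l₁ ++ l₂, ?_, ⟨_, _, h₁, h₂, by simp⟩, by simp⟩
        intro x hx
        exact (List.mem_append.1 hx).elim (hl₁ x) (hl₂ x)
    · rintro _ _ _ _ ⟨l₁, hl₁, h₁, rfl⟩ ⟨l₂, hl₂, h₂, rfl⟩ ⟨l₁', hl₁', h₁', rfl⟩
        ⟨l₂', hl₂', h₂', rfl⟩ he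
      have heq : l₁ ++ l₂ = l₁' ++ l₂' := by
        refine hc _ _ ?_ ?_ (by simpa using he) <;> intro x hx
        exacts [(List.mem_append.1 hx).elim (hl₁ x) (hl₂ x),
          (List.mem_append.1 hx).elim (hl₁' x) (hl₂' x)]
      have hm := hu _ _ _ _ h₁ h₂ h₁' h₂' (by simpa using congrArg (List.map (val ψ)) heq)
      have hlen : l₁.length = l₁'.length := by simpa using congrArg List.length hm.1
      obtain ⟨rfl, rfl⟩ := List.append_inj heq hlen
      exact ⟨rfl, rfl⟩
  | @plus L e _ he hcL ih =>
    have lift : ∀ m : List (List A), (∀ w ∈ m, w ∈ RE.decode ψ P L) →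
        ∃ n : List (List (List A)), (∀ l ∈ n, ∀ u ∈ l, u ∈ P) ∧
          (∀ l ∈ n, l.map (val ψ) ∈ L) ∧ m = n.map List.flatten := by
      intro m
      induction m with
      | nil => exact fun _ => ⟨[], by simp⟩
      | cons w m ihm =>
        intro hm
        obtain ⟨l, hl, hlL, rfl⟩ := hm w (by simp)
        obtain ⟨n, h₁, h₂, rfl⟩ := ihm fun x hx => hm x (by simp [hx])
        refine ⟨l :: n, ?_, ?_, by simp⟩
        · simpa using ⟨hl, h₁⟩
        · simpa using ⟨hlL, h₂⟩
    convert ih.plus he ?_ using 1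
    · ext w
      constructor
      · rintro ⟨l, hl, ⟨m, hm, hmL, heq⟩, rfl⟩
        have split : ∀ (m : List (List S)) (l : List (List A)), (∀ x ∈ m, x ∈ L) →
            (∀ u ∈ l, u ∈ P) → l.map (val ψ) = m.flatten →
            ∃ n : List (List A), n.length = m.length ∧ (∀ w ∈ n, w ∈ RE.decode ψ P L) ∧
              l.flatten = n.flatten := by
          intro m
          induction m with
          | nil =>
            intro l _ _ h
            obtain rfl : l = [] := by simpa using h
            exact ⟨[], by simp⟩
          | cons x m ihm =>
            intro l hm hl h
            rw [List.flatten_cons] at h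
            obtain ⟨l₁, l₂, rfl, rfl, h₂⟩ := List.map_eq_append_iff.1 h
            obtain ⟨n, hn, hnL, hf⟩ := ihm l₂ (fun y hy => hm y (by simp [hy]))
              (fun y hy => hl y (by simp [hy])) h₂
            refine ⟨l₁.flatten :: n, by simp [hn], ?_, by simp [hf]⟩
            intro w hw
            rcases List.mem_cons.1 hw with rfl | hw
            · exact ⟨l₁, fun y hy => hl y (by simp [hy]), hm _ (by simp), rfl⟩
            · exact hnL w hw
        obtain ⟨n, hn, hnL, hf⟩ := split m l hmL hl heq
        refine ⟨n, ?_, hnL, hf⟩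
        rintro rfl
        exact hm (List.length_eq_zero_iff.1 hn.symm)
      · rintro ⟨m, hm, hmD, rfl⟩
        obtain ⟨n, h₁, h₂, rfl⟩ := lift m hmD
        refine ⟨n.flatten, ?_, ⟨n.map (List.map (val ψ)), by simpa using hm, by simpa using h₂,
          by simp⟩, by simp [List.flatten_flatten]⟩
        intro u hu
        obtain ⟨l, hl, hul⟩ := List.mem_flatten.1 hu
        exact h₁ l hl u hul
    · intro m m' hm hm' heq
      obtain ⟨n, h₁, h₂, rfl⟩ := lift m hm
      obtain ⟨n', h₁', h₂', rfl⟩ := lift m' hm'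
      have hflat : n.flatten = n'.flatten := by
        refine hc _ _ ?_ ?_ (by simpa [List.flatten_flatten] using heq) <;> intro u hu <;>
          obtain ⟨l, hl, hul⟩ := List.mem_flatten.1 hu
        exacts [h₁ l hl u hul, h₁' l hl u hul]
      have hvals : n.map (List.map (val ψ)) = n'.map (List.map (val ψ)) := by
        refine hcL _ _ (by simpa using h₂) (by simpa using h₂') ?_
        simpa using congrArg (List.map (val ψ)) hflat
      have hlen : n.map List.length = n'.map List.length := by
        simpa [Function.comp_def] using congrArg (List.map List.length) hvals
      rw [List.eq_iff_flatten_eq.2 ⟨hflat, hlen⟩]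

/-- The nonempty words with letters in `T`. -/
def wordsOver {A : Type} (T : Set A) : Set (List A) := {w | w ≠ [] ∧ ∀ a ∈ w, a ∈ T}

theorem Nice.plus_of_words {ψ : A → S} {P : Set (List A)} (hP : Nice ψ P) (hc : Code P)
    {R : Set S} (hR : Nice (id : S → S) (wordsOver R)) (hv : ∀ w ∈ P, val ψ w ∈ R) :
    Nice ψ (plusLang P) := by
  intro s
  convert (hR s).decode hP hc using 1
  ext w
  constructor
  · rintro ⟨⟨l, hl, hlP, rfl⟩, hs⟩
    refine ⟨l, hlP, ⟨⟨by simpa using hl, ?_⟩, ?_⟩, rfl⟩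
    · simpa using fun u hu => hv u (hlP u hu)
    · simpa [val_flatten, val_id] using hs
  · rintro ⟨l, hl, ⟨⟨hne, _⟩, hs⟩, rfl⟩
    refine ⟨⟨l, by simpa using hne, hl, rfl⟩, ?_⟩
    simpa [val_flatten, val_id] using hs

theorem Nice.union_plus_union_cat [Finite S] {ψ : A → S} {L P : Set (List A)} (hL : Nice ψ L)
    (hP : Nice ψ (plusLang P)) (hne : [] ∉ L) (hF : FreeRight (insert [] L) P) :
    Nice ψ (L ∪ plusLang P ∪ catLang L (plusLang P)) := by
  refine (hL.union hP ?_).union (hL.cat hP ?_) ?_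
  · rintro _ hw ⟨l, hl, hlP, rfl⟩
    have := hF l [] [] _ hlP (by simp) (by simp) (.inr hw) (by simp)
    exact hl this.2
  · rintro u _ u' _ hu ⟨l, hl, hlP, rfl⟩ hu' ⟨l', hl', hlP', rfl⟩ he
    obtain ⟨rfl, rfl⟩ := hF l l' u u' hlP hlP' (.inr hu) (.inr hu') he
    exact ⟨rfl, rfl⟩
  · rintro _ (hw | ⟨l, hl, hlP, rfl⟩) ⟨u, _, hu, ⟨l', hl', hlP', rfl⟩, he⟩
    · have := hF [] l' _ u (by simp) hlP' (.inr hw) (.inr hu) (by simpa using he)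
      exact hl' this.2.symm
    · have := hF l l' [] u hlP hlP' (by simp) (.inr hu) (by simpa using he)
      exact hne (this.1 ▸ hu)

end Values

section Elimination

variable {A S : Type} [Monoid S]

/-- The words `c b` with all letters of `b` in `B`. -/
def blocks (c : A) (B : Set A) : Set (List A) := {w | ∃ b, (∀ a ∈ b, a ∈ B) ∧ w = c :: b}

theorem suffixCode_blocks {c : A} {B : Set A} (hc : c ∉ B) : SuffixCode (blocks c B) := by
  rintro _ ⟨b, hb, rfl⟩ _ ⟨b', hb', rfl⟩ v v' he
  have hcb : c ∉ b := fun h => hc (hb c h)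
  have hcb' : c ∉ b' := fun h => hc (hb' c h)
  rcases List.append_eq_append_iff.1 he with ⟨x, _, hx⟩ | ⟨x, _, hx⟩
  · cases x with
    | nil => simpa using hx
    | cons d x =>
      simp only [List.cons_append, List.cons.injEq] at hx
      exact absurd (by simp [hx.2]) hcb
  · cases x with
    | nil => simpa using hx.symm
    | cons d x =>
      simp only [List.cons_append, List.cons.injEq] at hx
      exact absurd (by simp [hx.2]) hcb'

theorem Nice.blocks [Finite S] {ψ : A → S} {c : A} {B : Set A} (hB : Nice ψ (wordsOver B)) :
    Nice ψ (blocks c B) := by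
  have h := (Nice.singleton ψ c).union ((Nice.singleton ψ c).cat hB ?_) ?_
  · convert h using 1
    ext w
    constructor
    · rintro ⟨b, hb, rfl⟩
      rcases eq_or_ne b [] with rfl | hne
      · exact .inl rfl
      · exact .inr ⟨[c], b, rfl, ⟨hne, hb⟩, rfl⟩
    · rintro (rfl | ⟨_, b, rfl, ⟨_, hb⟩, rfl⟩)
      exacts [⟨[], by simp, rfl⟩, ⟨b, hb, rfl⟩]
  · rintro _ v _ v' rfl _ rfl _ he
    exact ⟨rfl, List.append_cancel_left he⟩
  · rintro _ rfl ⟨_, b, rfl, ⟨hb, _⟩, he⟩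
    exact hb (by simpa using he)

theorem plusLang_blocks_pairs (Y : Set (List A)) :
    Y ∪ plusLang (catLang Y Y) ∪ catLang Y (plusLang (catLang Y Y)) = plusLang Y := by
  have unpair : ∀ l : List (List A), (∀ u ∈ l, u ∈ catLang Y Y) → l ≠ [] →
      l.flatten ∈ plusLang Y := by
    intro l
    induction l with
    | nil => simp
    | cons w l ih =>
      intro h _
      obtain ⟨u, v, hu, hv, rfl⟩ := h w (by simp)
      rcases eq_or_ne l [] with rfl | hne
      · exact ⟨[u, v], by simp, by simp [hu, hv], by simp⟩
      · obtain ⟨m, _, hm, he⟩ := ih (fun x hx => h x (by simp [hx])) hne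
        exact ⟨u :: v :: m, by simp, by simpa [hu, hv] using hm, by simp [he]⟩
  have pair : ∀ n : ℕ, ∀ l : List (List A), l.length ≤ n → (∀ u ∈ l, u ∈ Y) → l ≠ [] →
      l.flatten ∈ Y ∪ plusLang (catLang Y Y) ∪ catLang Y (plusLang (catLang Y Y)) := by
    intro n
    induction n using Nat.strong_induction_on with
    | _ n ih =>
      intro l hn hl hne
      match l, hn, hl, hne with
      | [u], _, hl, _ => exact .inl (.inl (by simpa using hl))
      | [u, v], _, hl, _ =>
        simp only [List.mem_cons, List.not_mem_nil, or_false, forall_eq_or_imp, forall_eq] at hl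
        exact .inl (.inr ⟨[u ++ v], by simp, by simpa using ⟨u, v, hl.1, hl.2, rfl⟩, by simp⟩)
      | u :: v :: x :: l, hn, hl, _ =>
        have hu : u ∈ Y := hl u (by simp)
        have hv : v ∈ Y := hl v (by simp)
        have hx : x ∈ Y := hl x (by simp)
        rcases ih (n - 2) (by simp at hn; omega) (x :: l) (by simp at hn ⊢; omega)
          (fun y hy => hl y (by simp at hy ⊢; tauto)) (by simp) with
          (h | ⟨m, hm, hmY, he⟩) | ⟨y, _, hy, ⟨m, hm, hmY, rfl⟩, he⟩
        · refine .inr ⟨u, v ++ (x :: l).flatten, hu, ⟨[v ++ (x :: l).flatten], by simp, ?_,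
            by simp⟩, by simp⟩
          simpa using ⟨v, _, hv, h, rfl⟩
        · refine .inl (.inr ⟨(u ++ v) :: m, by simp, ?_, ?_⟩)
          · simpa using ⟨⟨u, v, hu, hv, rfl⟩, hmY⟩
          · rw [List.flatten_cons, List.flatten_cons, he]
            simp
        · refine .inr ⟨u, ((v ++ y) :: m).flatten, hu, ⟨(v ++ y) :: m, by simp, ?_, rfl⟩, ?_⟩
          · simpa using ⟨⟨v, y, hv, hy, rfl⟩, hmY⟩
          · rw [List.flatten_cons, List.flatten_cons, he]
            simp
  ext w
  constructor
  · rintro ((h | ⟨l, hl, hlY, rfl⟩) | ⟨y, _, hy, ⟨l, hl, hlY, rfl⟩, rfl⟩)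
    · exact ⟨[w], by simp, by simpa using h, by simp⟩
    · exact unpair l hlY hl
    · obtain ⟨m, hm, hmY, he⟩ := unpair l hlY hl
      exact ⟨y :: m, by simp, by simpa [hy] using hmY, by simp [he]⟩
  · rintro ⟨l, hl, hlY, rfl⟩
    exact pair _ l le_rfl hlY hl

theorem wordsOver_insert (c : A) (B : Set A) :
    wordsOver B ∪ plusLang (blocks c B) ∪ catLang (wordsOver B) (plusLang (blocks c B)) =
      wordsOver (insert c B) := by
  have hblock : ∀ l : List (List A), (∀ u ∈ l, u ∈ blocks c B) →
      ∀ a ∈ l.flatten, a ∈ insert c B := by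
    intro l hl a ha
    obtain ⟨u, hu, hau⟩ := List.mem_flatten.1 ha
    obtain ⟨b, hb, rfl⟩ := hl u hu
    rcases List.mem_cons.1 hau with rfl | h
    exacts [.inl rfl, .inr (hb a h)]
  have hfne : ∀ l : List (List A), (∀ u ∈ l, u ∈ blocks c B) → l ≠ [] → l.flatten ≠ [] := by
    intro l hl hne
    obtain ⟨u, l, rfl⟩ := List.exists_cons_of_ne_nil hne
    obtain ⟨b, _, rfl⟩ := hl u (by simp)
    simp
  have split : ∀ w : List A, (∀ a ∈ w, a ∈ insert c B) → ∃ (b : List A) (l : List (List A)),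
      (∀ a ∈ b, a ∈ B) ∧
      (∀ u ∈ l, u ∈ blocks c B) ∧ w = b ++ l.flatten := by
    intro w
    induction w with
    | nil => exact fun _ => ⟨[], [], by simp⟩
    | cons a w ih =>
      intro h
      obtain ⟨b, l, hb, hl, rfl⟩ := ih fun x hx => h x (by simp [hx])
      rcases h a (by simp) with rfl | ha
      · refine ⟨[], (a :: b) :: l, by simp, ?_, by simp⟩
        intro u hu
        rcases List.mem_cons.1 hu with rfl | hu
        exacts [⟨b, hb, rfl⟩, hl u hu]
      · exact ⟨a :: b, l, by simpa [ha] using hb, hl, by simp⟩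
  ext w
  constructor
  · rintro ((h | ⟨l, hl, hlY, rfl⟩) | ⟨b, _, hb, ⟨l, hl, hlY, rfl⟩, rfl⟩)
    · exact ⟨h.1, fun a ha => .inr (h.2 a ha)⟩
    · exact ⟨hfne l hlY hl, hblock l hlY⟩
    · refine ⟨by simp [hb.1], fun a ha => ?_⟩
      exact (List.mem_append.1 ha).elim (fun h => .inr (hb.2 a h)) (hblock l hlY a)
  · rintro ⟨hne, hw⟩
    obtain ⟨b, l, hb, hl, rfl⟩ := split w hw
    rcases eq_or_ne l [] with rfl | hln
    · exact .inl (.inl (by simpa using ⟨by simpa using hne, hb⟩))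
    · rcases eq_or_ne b [] with rfl | hbn
      · exact .inl (.inr ⟨l, hln, hl, by simp⟩)
      · exact .inr ⟨b, _, ⟨hbn, hb⟩, ⟨l, hln, hl, rfl⟩, rfl⟩

theorem Nice.wordsOver_insert [Finite S] {ψ : A → S} {c : A} {B : Set A} (hc : c ∉ B) {R : Set S}
    (hR : ∀ x ∈ R, ∀ y ∈ R, x * y ∈ R) (hcR : ψ c ∈ R) (hBR : ∀ b ∈ B, ψ b ∈ R)
    (hB : Nice ψ (wordsOver B)) (hI : Nice (id : S → S) (wordsOver ((ψ c * ·) '' R))) :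
    Nice ψ (wordsOver (insert c B)) := by
  have hY := hB.blocks (c := c)
  have hsuf := suffixCode_blocks hc
  set Y := RE.blocks c B with hYdef
  have hmem : ∀ w ∈ Y, c ∈ w := by
    rintro _ ⟨b, _, rfl⟩
    simp
  have htail : ∀ b : List A, (∀ a ∈ b, a ∈ B) → c ∉ b := fun b hb h => hc (hb c h)
  have hvR : ∀ w ∈ Y, val ψ w ∈ R := by
    rintro _ ⟨b, hb, rfl⟩
    refine val_mem hR (by simp) fun a ha => ?_
    rcases List.mem_cons.1 ha with rfl | ha
    exacts [hcR, hBR a (hb a ha)]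
  have hFYY : FreeRight (insert [] Y) (catLang Y Y) := by
    refine (hsuf.catLang hsuf).freeRight ?_
    rintro _ ⟨u₁, u₂, hu₁, hu₂, rfl⟩ x v _ h
    rcases h with h | ⟨b, hb, h⟩
    · simp only [List.append_eq_nil_iff] at h
      simpa [h] using hmem u₁ hu₁
    · have hcu₂ := hmem u₂ hu₂
      have hcu₁ := hmem u₁ hu₁
      have hb' := htail b hb
      rw [← List.append_assoc, ← List.append_assoc] at h
      cases hz : v ++ x ++ u₁ with
      | nil =>
        rw [List.append_eq_nil_iff] at hz
        simp [hz.2] at hcu₁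
      | cons d z =>
        rw [hz, List.cons_append, List.cons.injEq] at h
        exact hb' (h.2 ▸ by simp [hcu₂])
  have hYY : Nice ψ (plusLang (catLang Y Y)) := by
    refine (hY.cat hY (hsuf.uniqueCat Y)).plus_of_words (hFYY.code (by simp)) hI ?_
    rintro _ ⟨_, v, ⟨b, hb, rfl⟩, hv, rfl⟩
    refine ⟨val ψ (b ++ v), ?_, by simp⟩
    rcases eq_or_ne b [] with rfl | hne
    · simpa using hvR v hv
    · rw [val_append]
      exact hR _ (val_mem hR hne fun a ha => hBR a (hb a ha)) _ (hvR v hv)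
  have hYp : Nice ψ (plusLang Y) := by
    rw [← plusLang_blocks_pairs]
    refine hY.union_plus_union_cat hYY ?_ hFYY
    rintro ⟨b, _, h⟩
    simp at h
  rw [← RE.wordsOver_insert]
  refine hB.union_plus_union_cat hYp (fun h => h.1 rfl) (hsuf.freeRight ?_)
  intro u hu x v _ h
  have hcu := hmem u hu
  rcases h with h | h
  · simp only [List.append_eq_nil_iff] at h
    simp [h] at hcu
  · exact hc (h.2 c (by simp [hcu]))

end Elimination

section Runs

variable {A S : Type} [Monoid S]

/-- The nonempty words over `T` leading from `g` to `h` in the right Cayley graph with all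
intermediate vertices in `Q`. -/
def runs (ψ : A → S) (T : Set A) (Q : Set S) (g h : S) : Set (List A) :=
  {w | w ∈ wordsOver T ∧ g * val ψ w = h ∧
    ∀ p r, p ≠ [] → r ≠ [] → w = p ++ r → g * val ψ p ∈ Q}

variable {ψ : A → S} {T : Set A}

theorem runs_ne_nil {Q : Set S} {g h : S} {w : List A} (hw : w ∈ runs ψ T Q g h) : w ≠ [] :=
  hw.1.1

theorem runs_mono {Q Q' : Set S} (hQ : Q ⊆ Q') {g h : S} : runs ψ T Q g h ⊆ runs ψ T Q' g h :=
  fun _ hw => ⟨hw.1, hw.2.1, fun p r hp hr he => hQ (hw.2.2 p r hp hr he)⟩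

theorem prefixCode_runs {Q : Set S} {g q : S} (hq : q ∉ Q) :
    PrefixCode (runs ψ T Q g q) := by
  intro u hu u' hu' v v' he
  rcases List.append_eq_append_iff.1 he with ⟨x, hx, _⟩ | ⟨x, hx, _⟩
  · rcases eq_or_ne x [] with rfl | hne
    · simpa using hx.symm
    · exact absurd (hu.2.1 ▸ hu'.2.2 u x hu.1.1 hne hx) hq
  · rcases eq_or_ne x [] with rfl | hne
    · simpa using hx
    · exact absurd (hu'.2.1 ▸ hu.2.2 u' x hu'.1.1 hne hx) hq

theorem append_notMem_runs {Q : Set S} {g h q : S} (hq : q ∉ Q) {u v : List A}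
    (hu : u ∈ runs ψ T Q g q) (hv : v ≠ []) : u ++ v ∉ runs ψ T Q g h :=
  fun hm => hq (hu.2.1 ▸ hm.2.2 u v hu.1.1 hv rfl)

theorem append_mem_runs {Q : Set S} {g h q : S} (hq : q ∈ Q) {u v : List A}
    (hu : u ∈ runs ψ T Q g q) (hv : v ∈ runs ψ T Q q h) : u ++ v ∈ runs ψ T Q g h := by
  refine ⟨⟨by simp [hu.1.1], fun a ha => ?_⟩, ?_, ?_⟩
  · exact (List.mem_append.1 ha).elim (hu.1.2 a) (hv.1.2 a)
  · rw [val_append, ← mul_assoc, hu.2.1, hv.2.1]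
  · intro p r hp hr he
    rcases List.append_eq_append_iff.1 he with ⟨x, rfl, hx⟩ | ⟨x, hx, _⟩
    · rcases eq_or_ne x [] with rfl | hne
      · rw [List.append_nil, hu.2.1]
        exact hq
      · rw [val_append, ← mul_assoc, hu.2.1]
        exact hv.2.2 x r hne hr hx
    · rcases eq_or_ne x [] with rfl | hne
      · rw [List.append_nil] at hx
        rw [← hx, hu.2.1]
        exact hq
      · exact hu.2.2 p x hp hne hx

theorem exists_first_visit {Q : Set S} {g h q : S} {w : List A}
    (hw : w ∈ runs ψ T (insert q Q) g h) (hn : w ∉ runs ψ T Q g h) :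
    ∃ u v, u ∈ runs ψ T Q g q ∧ v ∈ runs ψ T (insert q Q) q h ∧ w = u ++ v := by
  classical
  have hex : ∃ n, ∃ u v, u.length = n ∧ u ≠ [] ∧ v ≠ [] ∧ w = u ++ v ∧ g * val ψ u = q := by
    by_contra hcon
    refine hn ⟨hw.1, hw.2.1, fun p r hp hr he => ?_⟩
    rcases hw.2.2 p r hp hr he with h | h
    · exact absurd ⟨_, p, r, rfl, hp, hr, he, h⟩ hcon
    · exact h
  obtain ⟨u, v, hlen, hu, hv, rfl, hq⟩ := Nat.find_spec hex
  refine ⟨u, v, ⟨⟨hu, fun a ha => hw.1.2 a (by simp [ha])⟩, hq, ?_⟩,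
    ⟨⟨hv, fun a ha => hw.1.2 a (by simp [ha])⟩, ?_, ?_⟩, rfl⟩
  · rintro p r hp hr rfl
    rcases hw.2.2 p (r ++ v) hp (by simp [hr]) (by simp) with h | h
    · refine absurd ⟨p, r ++ v, rfl, hp, by simp [hr], by simp, h⟩ (Nat.find_min hex ?_)
      have := List.length_pos_iff.2 hr
      rw [← hlen, List.length_append]
      omega
    · exact h
  · rw [← hw.2.1, val_append, ← mul_assoc, hq]
  · rintro p r hp hr rfl
    have := hw.2.2 (u ++ p) r (by simp [hp]) hr (by simp)
    rwa [val_append, ← mul_assoc, hq] at this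

theorem runs_insert_loop {Q : Set S} {h q : S} :
    runs ψ T (insert q Q) q h =
      runs ψ T Q q h ∪ catLang (plusLang (runs ψ T Q q q)) (runs ψ T Q q h) := by
  ext w
  constructor
  · intro hw
    induction hn : w.length using Nat.strong_induction_on generalizing w with
    | _ n ih =>
      subst hn
      by_cases hmem : w ∈ runs ψ T Q q h
      · exact .inl hmem
      · obtain ⟨u, v, hu, hv, rfl⟩ := exists_first_visit hw hmem
        have := List.length_pos_iff.2 hu.1.1
        refine .inr ?_
        rcases ih v.length (by simp; omega) v hv rfl with h | ⟨_, y, ⟨l, hl, hlP, rfl⟩, hy, rfl⟩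
        · exact ⟨u, v, ⟨[u], by simp, by simpa using hu, by simp⟩, h, rfl⟩
        · exact ⟨(u :: l).flatten, y, ⟨u :: l, by simp, by simpa [hu] using hlP, rfl⟩, hy,
            by simp⟩
  · have hsub : Q ⊆ insert q Q := Set.subset_insert q Q
    rintro (h | ⟨_, v, ⟨l, -, hlP, rfl⟩, hv, rfl⟩)
    · exact runs_mono hsub h
    · induction l with
      | nil => exact runs_mono hsub hv
      | cons u l ih =>
        rw [List.flatten_cons, List.append_assoc]
        exact append_mem_runs (Set.mem_insert q Q) (runs_mono hsub (hlP u (by simp)))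
          (ih fun x hx => hlP x (by simp [hx]))

theorem runs_insert {Q : Set S} {g h q : S} :
    runs ψ T (insert q Q) g h =
      runs ψ T Q g h ∪ catLang (runs ψ T Q g q) (runs ψ T (insert q Q) q h) := by
  ext w
  constructor
  · intro hw
    by_cases hmem : w ∈ runs ψ T Q g h
    · exact .inl hmem
    · exact .inr (exists_first_visit hw hmem)
  · have hsub : Q ⊆ insert q Q := Set.subset_insert q Q
    rintro (h | ⟨u, v, hu, hv, rfl⟩)
    · exact runs_mono hsub h
    · exact append_mem_runs (Set.mem_insert q Q) (runs_mono hsub hu) hv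

theorem Nice.runs_empty (T : Finset A) (g h : S) : Nice ψ (runs ψ T ∅ g h) := by
  classical
  have hs := Nice.biUnion (ψ := ψ) (T.filter fun a => g * ψ a = h) (fun a => {[a]})
    (fun a _ => Nice.singleton ψ a) (by
      intro a _ b _ hab
      ext w
      simp only [Set.mem_inter_iff, Set.mem_singleton_iff, Set.mem_empty_iff_false, iff_false]
      rintro ⟨rfl, h⟩
      exact hab (by simpa using h))
  convert hs using 1
  ext w
  simp only [Set.mem_iUnion, Finset.mem_filter, Set.mem_singleton_iff, exists_prop]
  constructor
  · rintro ⟨⟨hne, hT⟩, hgh, hQ⟩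
    match w, hne, hT, hgh, hQ with
    | [a], _, hT, hgh, _ => exact ⟨a, ⟨by simpa using hT, by simpa using hgh⟩, rfl⟩
    | a :: b :: w, _, _, _, hQ => exact (hQ [a] (b :: w) (by simp) (by simp) rfl).elim
  · rintro ⟨a, ⟨ha, hga⟩, rfl⟩
    refine ⟨⟨by simp, by simpa using ha⟩, by simpa using hga, ?_⟩
    intro p r hp hr he
    have := congrArg List.length he
    have h₁ := List.length_pos_iff.2 hp
    have h₂ := List.length_pos_iff.2 hr
    simp at this
    omega

theorem Nice.runs_insert [Finite S] {Q : Set S} {q : S} (hq : q ∉ Q) {R : Set S}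
    (hR : ∀ x ∈ R, ∀ y ∈ R, x * y ∈ R) (hTR : ∀ a ∈ T, ψ a ∈ R) (hqR : Set.InjOn (q * ·) R)
    (hN : ∀ g h, Nice ψ (runs ψ T Q g h)) (g h : S) : Nice ψ (runs ψ T (insert q Q) g h) := by
  have hpre : PrefixCode (runs ψ T Q q q) := prefixCode_runs hq
  have hvR : ∀ w ∈ runs ψ T Q q q, val ψ w ∈ R := fun w hw =>
    val_mem hR hw.1.1 fun a ha => hTR a (hw.1.2 a ha)
  have hplus : Nice ψ (plusLang (runs ψ T Q q q)) := by
    have hcode : Code (runs ψ T Q q q) := hpre.code fun h => runs_ne_nil h rfl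
    rcases (runs ψ T Q q q).eq_empty_or_nonempty with he | ⟨u, hu⟩
    · refine (hN q q).plus_of_idempotent hcode (mul_one (1 : S)) ?_
      simp [he]
    · refine (hN q q).plus_of_idempotent hcode (e := val ψ u) ?_ fun w hw => ?_
      · refine hqR (hR _ (hvR u hu) _ (hvR u hu)) (hvR u hu) ?_
        simp only
        rw [← mul_assoc, hu.2.1, hu.2.1]
      · refine hqR (hvR w hw) (hvR u hu) ?_
        simp only
        rw [hw.2.1, hu.2.1]
  have hfree : FreeLeft (runs ψ T Q q q) (runs ψ T Q q h) := by
    refine hpre.freeLeft fun u hu x v hv => append_notMem_runs hq hu ?_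
    simp [runs_ne_nil hv]
  rw [RE.runs_insert]
  refine (hN g h).union ((hN g q).cat ?_ ((prefixCode_runs hq).uniqueCat _)) ?_
  · rw [runs_insert_loop]
    refine (hN q h).union (hplus.cat (hN q h) ?_) ?_
    · rintro _ v _ v' ⟨l, _, hl, rfl⟩ hv ⟨l', _, hl', rfl⟩ hv' he
      obtain ⟨rfl, rfl⟩ := hfree l l' v v' hl hl' hv hv' he
      exact ⟨rfl, rfl⟩
    · rintro w hw ⟨_, v, ⟨l, hne, hl, rfl⟩, hv, he⟩
      exact hne (hfree [] l w v (by simp) hl hw hv (by simpa using he)).1.symm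
  · rintro _ hw ⟨u, v, hu, hv, rfl⟩
    exact append_notMem_runs hq hu (runs_ne_nil hv) hw

theorem Nice.wordsOver_of_injOn [Finite S] {T : Finset A} {R : Set S}
    (hR : ∀ x ∈ R, ∀ y ∈ R, x * y ∈ R) (hTR : ∀ a ∈ T, ψ a ∈ R)
    (hinj : ∀ a ∈ T, Set.InjOn (ψ a * ·) R) : Nice ψ (wordsOver (T : Set A)) := by
  classical
  have := Fintype.ofFinite S
  have hruns : ∀ Q : Finset S, (∀ q ∈ Q, Set.InjOn (q * ·) R) →
      ∀ g h, Nice ψ (runs ψ T Q g h) := by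
    intro Q
    induction Q using Finset.induction_on with
    | empty =>
      intro _ g h
      simpa using Nice.runs_empty T g h
    | insert q Q hq ih =>
      intro hQ g h
      rw [Finset.coe_insert]
      exact Nice.runs_insert (by simpa using hq) hR hTR (hQ q (by simp))
        (ih fun r hr => hQ r (by simp [hr])) g h
  have hval : ∀ w : List A, (∀ a ∈ w, a ∈ T) → Set.InjOn (val ψ w * ·) R := by
    intro w
    induction w with
    | nil => simp [Set.InjOn]
    | cons a w ih =>
      intro hw x hx y hy he
      have haw := hw a (by simp)
      have hwR : ∀ z ∈ R, val ψ w * z ∈ R := by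
        intro z hz
        rcases eq_or_ne w [] with rfl | hne
        · simpa using hz
        · exact hR _ (val_mem hR hne fun b hb => hTR b (hw b (by simp [hb]))) _ hz
      refine ih (fun b hb => hw b (by simp [hb])) hx hy (hinj a haw (hwR x hx) (hwR y hy) ?_)
      simpa [mul_assoc] using he
  have hN := Nice.biUnion (ψ := ψ) Finset.univ
    (fun h => runs ψ T (Finset.univ.filter fun q : S => Set.InjOn (q * ·) R : Finset S) 1 h)
    (fun h _ => hruns _ (by simp) 1 h) (by
      intro g _ h _ hgh
      ext w
      simp only [Set.mem_inter_iff, Set.mem_empty_iff_false, iff_false]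
      rintro ⟨h₁, h₂⟩
      exact hgh (h₁.2.1.symm.trans h₂.2.1))
  convert hN using 1
  ext w
  simp only [Finset.mem_univ, Set.iUnion_true, Set.mem_iUnion]
  constructor
  · intro hw
    refine ⟨val ψ w, hw, one_mul _, ?_⟩
    rintro p r _ _ rfl
    simpa using hval p fun a ha => hw.2 a (by simp [ha])
  · rintro ⟨h, hw⟩
    exact hw.1

end Runs

theorem nice_wordsOver {S : Type} [Monoid S] [Finite S] (R : Set S)
    (hR : ∀ x ∈ R, ∀ y ∈ R, x * y ∈ R) {A : Type} (ψ : A → S) (T : Finset A)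
    (hT : ∀ a ∈ T, ψ a ∈ R) : Nice ψ (wordsOver (T : Set A)) := by
  classical
  induction hn : R.ncard using Nat.strong_induction_on generalizing R A with
  | _ n ih =>
    subst hn
    induction T using Finset.strongInduction with
    | H T ihT =>
      by_cases hinj : ∀ a ∈ T, Set.InjOn (ψ a * ·) R
      · exact Nice.wordsOver_of_injOn hR hT hinj
      · push Not at hinj
        obtain ⟨c, hc, hcR⟩ := hinj
        have hlt : ((ψ c * ·) '' R).ncard < R.ncard :=
          lt_of_le_of_ne (Set.ncard_image_le R.toFinite)
            fun h => hcR ((Set.ncard_image_iff R.toFinite).1 h)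
        have hIR : ∀ x ∈ (ψ c * ·) '' R, ∀ y ∈ (ψ c * ·) '' R, x * y ∈ (ψ c * ·) '' R := by
          rintro _ ⟨x, hx, rfl⟩ _ ⟨y, hy, rfl⟩
          exact ⟨x * (ψ c * y), hR _ hx _ (hR _ (hT c hc) _ hy), by simp [mul_assoc]⟩
        have hI := ih _ hlt _ hIR (id : S → S) ((ψ c * ·) '' R).toFinite.toFinset
          (by simp) rfl
        rw [Set.Finite.coe_toFinset] at hI
        have hB := ihT (T.erase c) (Finset.erase_ssubset hc)
          fun a ha => hT a (Finset.mem_of_mem_erase ha)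
        rw [← Finset.insert_erase hc, Finset.coe_insert]
        exact Nice.wordsOver_insert (by simp) hR (hT c hc)
          (fun b hb => hT b (Finset.mem_of_mem_erase hb)) hB hI

end RE

/-- **Unambiguous forest factorization, finite words (T₁).**
For a morphism `φ : Σ* → S` to a finite monoid and every `s ∈ S` there is an
`ε`-free `φ`-good rational expression `F s` with `L(F s) = φ⁻¹(s) \ {ε}`;
consequently the `F s` have pairwise disjoint languages whose union is `Σ⁺`,
so `G = ⋃ₛ F s` is an unambiguous rational expression denoting `Σ⁺`. -/
theorem unambiguous_forest_factorization_finite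
    {A S : Type} [Fintype A] [Monoid S] [Fintype S]
    (φ : List A → S) (hφ : ∀ u v : List A, φ (u ++ v) = φ u * φ v)
    (hφ1 : φ [] = 1) :
    ∃ F : S → RE A,
      (∀ s : S, (F s).epsFree ∧ (F s).Good φ ∧
        (F s).lang = {w : List A | w ≠ [] ∧ φ w = s}) ∧
      (⋃ s : S, (F s).lang) = {w : List A | w ≠ []} ∧
      (∀ s t : S, s ≠ t → (F s).lang ∩ (F t).lang = ∅) := by
  have hval : φ = RE.val fun a => φ [a] := by
    funext w
    induction w with
    | nil => simpa using hφ1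
    | cons a w ih => rw [← List.singleton_append, hφ, ih, RE.val_append]; simp
  have hN := RE.nice_wordsOver Set.univ (by simp) (fun a => φ [a]) Finset.univ (by simp)
  choose F hF₁ hF₂ hF₃ using fun s => (hN s).exists_expr
  have hL : ∀ s, (F s).lang = {w : List A | w ≠ [] ∧ φ w = s} := by
    intro s
    rw [hF₃ s, ← hval]
    ext w
    simp [RE.wordsOver]
  refine ⟨F, fun s => ⟨hF₁ s, by rw [hval]; exact hF₂ s, hL s⟩, ?_, ?_⟩
  · ext w
    simp [hL]
  · intro s t hst
    rw [hL, hL]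
    ext w
    simp only [Set.mem_inter_iff, Set.mem_ofPred_eq, Set.mem_empty_iff_false, iff_false]
    rintro ⟨⟨_, hs⟩, ⟨_, ht⟩⟩
    exact hst (hs.symm.trans ht)
end

section
/- Let Σ be a finite alphabet and φ: Σ* → S a morphism to a finite monoid S. There exist m ≥ 1 and ε-free φ-good rational expressions F_1, G_1, …, F_m, G_m over Σ such that the ω-regular expression G = ⋃_{k=1}^m F_k · G_k^ω is unambiguous (every infinite word over Σ has exactly one decomposition according to G), L(G) = Σ^ω, and for each 1 ≤ k ≤ m the element s_k ∈ S with L(G_k) ⊆ φ⁻¹(s_k) is an idempotent of S. -/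
/-- `u` is a prefix of the infinite word `w : ℕ → A`. -/
def IsPrefixOfInf {A : Type} (u : List A) (w : ℕ → A) : Prop :=
  ∀ i : Fin u.length, w i = u.get i

namespace OmegaRat

/-- Concatenation of languages of finite words. -/
def catL {B : Type} (L M : Set (List B)) : Set (List B) :=
  {w | ∃ u v, u ∈ L ∧ v ∈ M ∧ w = u ++ v}

/-- Kleene plus. -/
def plusL {B : Type} (L : Set (List B)) : Set (List B) :=
  {w | ∃ l : List (List B), l ≠ [] ∧ (∀ u ∈ l, u ∈ L) ∧ w = l.flatten}

/-- Kleene star. -/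
def starL {B : Type} (L : Set (List B)) : Set (List B) :=
  {w | ∃ l : List (List B), (∀ u ∈ l, u ∈ L) ∧ w = l.flatten}

/-- Concatenation of a language of finite words with a set of infinite words. -/
def catS {B : Type} (L : Set (List B)) (X : Set (Stream' B)) : Set (Stream' B) :=
  {x | ∃ u y, u ∈ L ∧ y ∈ X ∧ x = u ++ₛ y}

/-- `x` is the infinite concatenation of the words `g 0, g 1, …`, witnessed by the sequence of its
successive tails. -/
def InfCat {B : Type} (g : Stream' (List B)) (x : Stream' B) : Prop :=
  ∃ W : ℕ → Stream' B, W 0 = x ∧ ∀ n, W n = g.get n ++ₛ W (n + 1)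

/-- The `ω`-power of a language. -/
def omegaL {B : Type} (K : Set (List B)) : Set (Stream' B) :=
  {x | ∃ g : Stream' (List B), (∀ n, g.get n ∈ K) ∧ InfCat g x}

/-- The concatenation of `L` and `M` is unambiguous. -/
def UCat {B : Type} (L M : Set (List B)) : Prop :=
  ∀ u v u₂ v₂, u ∈ L → v ∈ M → u₂ ∈ L → v₂ ∈ M → u ++ v = u₂ ++ v₂ → u = u₂ ∧ v = v₂

/-- The concatenation of `L` and `X` is unambiguous. -/
def UCatS {B : Type} (L : Set (List B)) (X : Set (Stream' B)) : Prop :=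
  ∀ u x u₂ x₂, u ∈ L → x ∈ X → u₂ ∈ L → x₂ ∈ X → u ++ₛ x = u₂ ++ₛ x₂ → u = u₂ ∧ x = x₂

/-- Factorizations of finite words over `K` are unique. -/
def Code {B : Type} (K : Set (List B)) : Prop :=
  ∀ l m : List (List B), (∀ u ∈ l, u ∈ K) → (∀ u ∈ m, u ∈ K) → l.flatten = m.flatten → l = m

/-- Factorizations of infinite words over `K` are unique. -/
def OCode {B : Type} (K : Set (List B)) : Prop :=
  ∀ (g g' : Stream' (List B)) (x : Stream' B), (∀ n, g.get n ∈ K) → (∀ n, g'.get n ∈ K) →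
    InfCat g x → InfCat g' x → g = g'

variable {B : Type}

theorem append_stream_eq_append_stream {u u' : List B} {x x' : Stream' B}
    (h : u ++ₛ x = u' ++ₛ x') :
    (∃ t, u' = u ++ t ∧ x = t ++ₛ x') ∨ (∃ t, u = u' ++ t ∧ x' = t ++ₛ x) := by
  induction u generalizing u' with
  | nil => exact Or.inl ⟨u', rfl, h⟩
  | cons a u ih =>
    cases u' with
    | nil => exact Or.inr ⟨a :: u, rfl, h.symm⟩
    | cons b u' =>
      rw [Stream'.cons_append_stream, Stream'.cons_append_stream] at h
      obtain ⟨rfl, htail⟩ := Stream'.cons_injective2 h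
      rcases ih htail with ⟨t, rfl, rfl⟩ | ⟨t, rfl, rfl⟩
      · exact Or.inl ⟨t, rfl, rfl⟩
      · exact Or.inr ⟨t, rfl, rfl⟩

theorem InfCat.step {g : Stream' (List B)} {x : Stream' B} (h : InfCat g x) :
    ∃ y, x = g.head ++ₛ y ∧ InfCat g.tail y := by
  obtain ⟨W, rfl, hW⟩ := h
  exact ⟨W 1, hW 0, fun n => W (n + 1), rfl, fun n => hW (n + 1)⟩

theorem InfCat.cons {u : List B} {g : Stream' (List B)} {y : Stream' B} (h : InfCat g y) :
    InfCat (Stream'.cons u g) (u ++ₛ y) := by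
  obtain ⟨W, rfl, hW⟩ := h
  refine ⟨fun n => Nat.casesOn n (u ++ₛ W 0) W, rfl, fun n => ?_⟩
  cases n with
  | zero => rfl
  | succ n => exact hW n

theorem InfCat.append {l : List (List B)} {g : Stream' (List B)} {y : Stream' B} (h : InfCat g y) :
    InfCat (l ++ₛ g) (l.flatten ++ₛ y) := by
  induction l with
  | nil => exact h
  | cons u l ih =>
    rw [Stream'.cons_append_stream, List.flatten_cons, Stream'.append_append_stream]
    exact ih.cons

theorem InfCat.split {l : List (List B)} {g : Stream' (List B)} {x : Stream' B}
    (h : InfCat (l ++ₛ g) x) : ∃ y, x = l.flatten ++ₛ y ∧ InfCat g y := by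
  induction l generalizing x with
  | nil => exact ⟨x, rfl, h⟩
  | cons u l ih =>
    obtain ⟨y, hx, hy⟩ := h.step
    obtain ⟨z, hy', hz⟩ := ih hy
    refine ⟨z, ?_, hz⟩
    rw [List.flatten_cons, Stream'.append_append_stream, ← hy']
    exact hx

/-- Coinduction principle for `InfCat`. -/
theorem InfCat.of_step {g : Stream' (List B)} (P : ℕ → Stream' B → Prop)
    (hP : ∀ n x, P n x → ∃ y, x = g.get n ++ₛ y ∧ P (n + 1) y) {x : Stream' B} (hx : P 0 x) :
    InfCat g x := by
  have : Nonempty (Stream' B) := ⟨x⟩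
  choose! f hf hPf using hP
  let W : ℕ → Stream' B := fun n => Nat.rec x (fun n y => f n y) n
  have hW : ∀ n, P n (W n) := fun n => by
    induction n with
    | zero => exact hx
    | succ n ih => exact hPf n _ ih
  exact ⟨W, rfl, fun n => hf n _ (hW n)⟩

/-- Coinduction principle for the `ω`-power. -/
theorem mem_omegaL_of_step {K : Set (List B)} (P : Stream' B → Prop)
    (hP : ∀ x, P x → ∃ k ∈ K, ∃ y, x = k ++ₛ y ∧ P y) {x : Stream' B} (hx : P x) :
    x ∈ omegaL K := by
  have : Nonempty (Stream' B) := ⟨x⟩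
  choose! k hk f hf hPf using hP
  let W : ℕ → Stream' B := fun n => Nat.rec x (fun _ y => f y) n
  have hW : ∀ n, P (W n) := fun n => by
    induction n with
    | zero => exact hx
    | succ n ih => exact hPf _ ih
  exact ⟨fun n => k (W n), fun n => hk _ (hW n), W, rfl, fun n => hf _ (hW n)⟩

theorem omegaL_step {K : Set (List B)} {x : Stream' B} (hx : x ∈ omegaL K) :
    ∃ k ∈ K, ∃ y ∈ omegaL K, x = k ++ₛ y := by
  obtain ⟨g, hg, hx⟩ := hx
  obtain ⟨y, h, hy⟩ := hx.step
  exact ⟨_, hg 0, y, ⟨g.tail, fun n => hg (n + 1), hy⟩, h⟩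

theorem cons_mem_omegaL {K : Set (List B)} {k : List B} {y : Stream' B} (hk : k ∈ K)
    (hy : y ∈ omegaL K) : k ++ₛ y ∈ omegaL K := by
  obtain ⟨g, hg, hy⟩ := hy
  exact ⟨Stream'.cons k g, fun n => Nat.casesOn n hk hg, hy.cons⟩

theorem omegaL_eq_catS (K : Set (List B)) : omegaL K = catS K (omegaL K) := by
  ext x
  constructor
  · intro hx
    obtain ⟨k, hk, y, hy, rfl⟩ := omegaL_step hx
    exact ⟨k, y, hk, hy, rfl⟩
  · rintro ⟨k, y, hk, hy, rfl⟩
    exact cons_mem_omegaL hk hy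

/-- Two factorizations of an infinite word with the same lengths of factors coincide. -/
theorem InfCat.eq_of_length {g g' : Stream' (List B)} {x : Stream' B} (h : InfCat g x)
    (h' : InfCat g' x) (hl : ∀ n, (g.get n).length = (g'.get n).length) : g = g' := by
  obtain ⟨W, hW0, hW⟩ := h
  obtain ⟨W', hW0', hW'⟩ := h'
  have key : ∀ n, W n = W' n := by
    intro n
    induction n with
    | zero => rw [hW0, hW0']
    | succ n ih =>
      rw [hW, hW'] at ih
      have := Stream'.append_left_injective _ _ _ _ ih (hl n)
      rw [this] at ih
      exact Stream'.append_right_injective _ _ _ ih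
  refine Stream'.ext fun n => ?_
  have := key n
  rw [hW, hW'] at this
  exact Stream'.append_left_injective _ _ _ _ this (hl n)

theorem InfCat.map {C : Type} (f : B → C) {g : Stream' (List B)} {x : Stream' B}
    (h : InfCat g x) : InfCat (Stream'.map (List.map f) g) (Stream'.map f x) := by
  obtain ⟨W, rfl, hW⟩ := h
  refine ⟨fun n => Stream'.map f (W n), rfl, fun n => ?_⟩
  simp only [Stream'.get_map]
  rw [← Stream'.map_append_stream, ← hW]

theorem InfCat.flatten {l : Stream' (List (List B))} {h : Stream' (List B)} {x : Stream' B}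
    (hl : InfCat l h) (hx : InfCat h x) : InfCat (Stream'.map List.flatten l) x := by
  obtain ⟨H, rfl, hH⟩ := hl
  refine InfCat.of_step (fun n y => InfCat (H n) y) (fun n y hy => ?_) hx
  rw [hH] at hy
  exact hy.split

theorem InfCat.unflatten {l : Stream' (List (List B))} {h : Stream' (List B)} {x : Stream' B}
    (hl : InfCat l h) (hne : ∀ n, l.get n ≠ []) (hx : InfCat (Stream'.map List.flatten l) x) :
    InfCat h x := by
  obtain ⟨H, rfl, hH⟩ := hl
  obtain ⟨W, rfl, hW⟩ := hx
  refine InfCat.of_step (fun n y => ∃ m r, (H 0).drop n = r ++ₛ H m ∧ y = r.flatten ++ₛ W m)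
    ?_ ⟨0, [], rfl, rfl⟩
  have main : ∀ n m r, r ≠ [] → (H 0).drop n = r ++ₛ H m → ∃ y,
      r.flatten ++ₛ W m = (H 0).get n ++ₛ y ∧
        ∃ m r, (H 0).drop (n + 1) = r ++ₛ H m ∧ y = r.flatten ++ₛ W m := by
    intro n m r hr hd
    cases r with
    | nil => exact absurd rfl hr
    | cons k r =>
      have h1 : (H 0).get n = k := by
        rw [← Stream'.head_drop, hd]
        rfl
      refine ⟨r.flatten ++ₛ W m, ?_, m, r, ?_, rfl⟩
      · rw [h1, List.flatten_cons, Stream'.append_append_stream]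
      · rw [← Stream'.tail_drop', hd]
        rfl
  rintro n y ⟨m, r, hd, rfl⟩
  by_cases hr : r = []
  · subst hr
    have := main n (m + 1) (l.get m) (hne m) (by rw [hd, Stream'.nil_append_stream, hH])
    simpa [hW m, Stream'.get_map] using this
  · exact main n m r hr hd

theorem exists_infCat (l : Stream' (List B)) (hne : ∀ n, l.get n ≠ []) : ∃ x, InfCat l x := by
  have hlen : ∀ n m, n < (((List.range' m (n + 1)).map l.get).flatten).length := by
    intro n
    induction n with
    | zero =>
      intro m
      simpa [List.range'] using List.length_pos_of_ne_nil (hne m)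
    | succ n ih =>
      intro m
      have := ih (m + 1)
      have h1 := List.length_pos_of_ne_nil (hne m)
      rw [List.range'_succ, List.map_cons, List.flatten_cons, List.length_append]
      omega
  let W : ℕ → Stream' B := fun m n => (((List.range' m (n + 1)).map l.get).flatten)[n]'(hlen n m)
  refine ⟨W 0, W, rfl, fun m => Stream'.ext fun n => ?_⟩
  have hWn : (W m).get n = (((List.range' m (n + 1)).map l.get).flatten)[n]'(hlen n m) := rfl
  rw [hWn]
  have e : ((List.range' m (n + 1)).map l.get).flatten =
      l.get m ++ ((List.range' (m + 1) n).map l.get).flatten := by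
    rw [List.range'_succ, List.map_cons, List.flatten_cons]
  by_cases hn : n < (l.get m).length
  · rw [Stream'.get_append_left _ _ _ hn]
    simp only [e]
    rw [List.getElem_append_left]
  · obtain ⟨j, hj⟩ := Nat.exists_eq_add_of_le (not_lt.mp hn)
    have h1 := List.length_pos_of_ne_nil (hne m)
    have hWj : (W (m + 1)).get j =
        (((List.range' (m + 1) (j + 1)).map l.get).flatten)[j]'(hlen j (m + 1)) := rfl
    subst hj
    rw [Stream'.get_append_right, hWj]
    simp only [e]
    rw [List.getElem_append_right (by omega)]
    obtain ⟨d, hd⟩ : ∃ d, (l.get m).length + j = (j + 1) + d := ⟨(l.get m).length - 1, by omega⟩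
    have e2 : ((List.range' (m + 1) ((l.get m).length + j)).map l.get).flatten =
        ((List.range' (m + 1) (j + 1)).map l.get).flatten ++
          ((List.range' (m + 1 + (j + 1)) d).map l.get).flatten := by
      rw [hd, ← List.range'_append_1, List.map_append, List.flatten_append]
    simp only [e2, Nat.add_sub_cancel_left]
    rw [List.getElem_append_left]

/-- The first letter of `w`, if any, lies in `H`. -/
def HeadIn (H : Set B) (w : List B) : Prop := ∀ b t, w = b :: t → b ∈ H

/-- A word of `K` cannot be prolonged inside `K` by a word starting with a letter of `H`. -/
def Sync (H : Set B) (K : Set (List B)) : Prop := ∀ u b t, u ∈ K → u ++ b :: t ∈ K → b ∉ H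

theorem HeadIn.append {H : Set B} {u v : List B} (h : HeadIn H u) (hu : u ≠ []) :
    HeadIn H (u ++ v) := by
  cases u with
  | nil => exact absurd rfl hu
  | cons a u =>
    rintro b t e
    obtain ⟨rfl, -⟩ := List.cons.inj e
    exact h a u rfl

theorem HeadIn.head_append {H : Set B} {u : List B} (h : HeadIn H u) (hu : u ≠ [])
    (x : Stream' B) : (u ++ₛ x).head ∈ H := by
  cases u with
  | nil => exact absurd rfl hu
  | cons a u => exact h a u rfl

theorem headIn_flatten {H : Set B} {K : Set (List B)} (hH : ∀ k ∈ K, HeadIn H k)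
    {l : List (List B)} (hl : ∀ k ∈ l, k ∈ K) {v : List B} (hv : HeadIn H v) :
    HeadIn H (l.flatten ++ v) := by
  induction l with
  | nil => exact hv
  | cons k l ih =>
    have h1 := ih fun k hk => hl k (List.mem_cons_of_mem _ hk)
    by_cases hk : k = []
    · subst hk
      exact h1
    · rw [List.flatten_cons, List.append_assoc]
      exact (hH k (hl k List.mem_cons_self)).append hk

theorem head_flatten_append {H : Set B} {K : Set (List B)} (hH : ∀ k ∈ K, HeadIn H k)
    {l : List (List B)} (hl : ∀ k ∈ l, k ∈ K) {x : Stream' B} (hx : x.head ∈ H) :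
    (l.flatten ++ₛ x).head ∈ H := by
  induction l with
  | nil => exact hx
  | cons k l ih =>
    have h1 := ih fun k hk => hl k (List.mem_cons_of_mem _ hk)
    by_cases hk : k = []
    · subst hk
      exact h1
    · rw [List.flatten_cons, Stream'.append_append_stream]
      exact (hH k (hl k List.mem_cons_self)).head_append hk _

theorem head_mem_of_mem_omegaL {H : Set B} {K : Set (List B)} (hH : ∀ k ∈ K, HeadIn H k)
    (hne : [] ∉ K) {x : Stream' B} (hx : x ∈ omegaL K) : x.head ∈ H := by
  obtain ⟨k, hk, y, -, rfl⟩ := omegaL_step hx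
  exact (hH k hk).head_append (fun h => hne (h ▸ hk)) y

namespace Sync

variable {H : Set B} {K : Set (List B)}

theorem append_inj (hs : Sync H K) {u u' v v' : List B} (hu : u ∈ K) (hu' : u' ∈ K)
    (hv : HeadIn H v) (hv' : HeadIn H v') (h : u ++ v = u' ++ v') : u = u' ∧ v = v' := by
  rcases List.append_eq_append_iff.mp h with ⟨t, rfl, rfl⟩ | ⟨t, rfl, rfl⟩
  · cases t with
    | nil => simp
    | cons b t => exact absurd (hv b _ rfl) (hs _ _ _ hu hu')
  · cases t with
    | nil => simp
    | cons b t => exact absurd (hv' b _ rfl) (hs _ _ _ hu' hu)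

theorem append_stream_inj (hs : Sync H K) {u u' : List B} {x x' : Stream' B} (hu : u ∈ K)
    (hu' : u' ∈ K) (hx : x.head ∈ H) (hx' : x'.head ∈ H) (h : u ++ₛ x = u' ++ₛ x') :
    u = u' ∧ x = x' := by
  rcases append_stream_eq_append_stream h with ⟨t, rfl, rfl⟩ | ⟨t, rfl, rfl⟩
  · cases t with
    | nil => simp
    | cons b t => exact absurd hx (hs _ _ _ hu hu')
  · cases t with
    | nil => simp
    | cons b t => exact absurd hx' (hs _ _ _ hu' hu)

theorem ucat (hs : Sync H K) {M : Set (List B)} (hM : ∀ v ∈ M, HeadIn H v) : UCat K M :=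
  fun _ _ _ _ hu hv hu' hv' h => hs.append_inj hu hu' (hM _ hv) (hM _ hv') h

theorem ucatS (hs : Sync H K) {X : Set (Stream' B)} (hX : ∀ x ∈ X, x.head ∈ H) : UCatS K X :=
  fun _ _ _ _ hu hx hu' hx' h => hs.append_stream_inj hu hu' (hX _ hx) (hX _ hx') h

theorem flatten_append_inj (hs : Sync H K) (hH : ∀ k ∈ K, HeadIn H k) {V : Set (List B)}
    (hV : ∀ v ∈ V, HeadIn H v) (hno : ∀ k ∈ K, ∀ z, HeadIn H z → k ++ z ∉ V)
    {l l' : List (List B)} {v v' : List B} (hl : ∀ k ∈ l, k ∈ K) (hl' : ∀ k ∈ l', k ∈ K)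
    (hv : v ∈ V) (hv' : v' ∈ V) (h : l.flatten ++ v = l'.flatten ++ v') : l = l' ∧ v = v' := by
  induction l generalizing l' with
  | nil =>
    cases l' with
    | nil => exact ⟨rfl, h⟩
    | cons k l' =>
      rw [List.forall_mem_cons] at hl'
      rw [List.flatten_nil, List.nil_append, List.flatten_cons, List.append_assoc] at h
      exact absurd (h ▸ hv) (hno k hl'.1 _ (headIn_flatten hH hl'.2 (hV _ hv')))
  | cons k l ih =>
    rw [List.forall_mem_cons] at hl
    rw [List.flatten_cons, List.append_assoc] at h
    cases l' with
    | nil =>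
      exact absurd (show k ++ (l.flatten ++ v) ∈ V from h ▸ hv')
        (hno k hl.1 _ (headIn_flatten hH hl.2 (hV _ hv)))
    | cons k' l' =>
      rw [List.forall_mem_cons] at hl'
      rw [List.flatten_cons, List.append_assoc] at h
      obtain ⟨rfl, h2⟩ := hs.append_inj hl.1 hl'.1 (headIn_flatten hH hl.2 (hV _ hv))
        (headIn_flatten hH hl'.2 (hV _ hv')) h
      obtain ⟨rfl, rfl⟩ := ih hl.2 hl'.2 h2
      exact ⟨rfl, rfl⟩

theorem ucat_star (hs : Sync H K) (hH : ∀ k ∈ K, HeadIn H k) {V : Set (List B)}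
    (hV : ∀ v ∈ V, HeadIn H v) (hno : ∀ k ∈ K, ∀ z, HeadIn H z → k ++ z ∉ V) :
    UCat (starL K) V := by
  rintro _ v _ v' ⟨l, hl, rfl⟩ hv ⟨l', hl', rfl⟩ hv' h
  obtain ⟨rfl, rfl⟩ := hs.flatten_append_inj hH hV hno hl hl' hv hv' h
  exact ⟨rfl, rfl⟩

theorem code (hs : Sync H K) (hH : ∀ k ∈ K, HeadIn H k) (hne : [] ∉ K) : Code K := by
  intro l l' hl hl' h
  refine (hs.flatten_append_inj hH (V := {[]}) (v := []) (v' := []) ?_ ?_ hl hl' rfl rfl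
    (by simpa using h)).1
  · rintro v rfl b t h
    exact absurd h (by simp)
  · rintro k hk z - h
    obtain ⟨rfl, -⟩ := List.append_eq_nil_iff.mp h
    exact hne hk

theorem flatten_append_stream_inj (hs : Sync H K) (hH : ∀ k ∈ K, HeadIn H k)
    {V : Set (Stream' B)} (hV : ∀ v ∈ V, v.head ∈ H)
    (hno : ∀ k ∈ K, ∀ z : Stream' B, z.head ∈ H → k ++ₛ z ∉ V)
    {l l' : List (List B)} {v v' : Stream' B} (hl : ∀ k ∈ l, k ∈ K) (hl' : ∀ k ∈ l', k ∈ K)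
    (hv : v ∈ V) (hv' : v' ∈ V) (h : l.flatten ++ₛ v = l'.flatten ++ₛ v') : l = l' ∧ v = v' := by
  induction l generalizing l' with
  | nil =>
    cases l' with
    | nil => exact ⟨rfl, h⟩
    | cons k l' =>
      rw [List.forall_mem_cons] at hl'
      rw [List.flatten_nil, Stream'.nil_append_stream, List.flatten_cons,
        Stream'.append_append_stream] at h
      exact absurd (h ▸ hv) (hno k hl'.1 _ (head_flatten_append hH hl'.2 (hV _ hv')))
  | cons k l ih =>
    rw [List.forall_mem_cons] at hl
    rw [List.flatten_cons, Stream'.append_append_stream] at h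
    cases l' with
    | nil =>
      exact absurd (show k ++ₛ (l.flatten ++ₛ v) ∈ V from h ▸ hv')
        (hno k hl.1 _ (head_flatten_append hH hl.2 (hV _ hv)))
    | cons k' l' =>
      rw [List.forall_mem_cons] at hl'
      rw [List.flatten_cons, Stream'.append_append_stream] at h
      obtain ⟨rfl, h2⟩ := hs.append_stream_inj hl.1 hl'.1 (head_flatten_append hH hl.2 (hV _ hv))
        (head_flatten_append hH hl'.2 (hV _ hv')) h
      obtain ⟨rfl, rfl⟩ := ih hl.2 hl'.2 h2
      exact ⟨rfl, rfl⟩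

theorem ucatS_star (hs : Sync H K) (hH : ∀ k ∈ K, HeadIn H k) {V : Set (Stream' B)}
    (hV : ∀ v ∈ V, v.head ∈ H) (hno : ∀ k ∈ K, ∀ z : Stream' B, z.head ∈ H → k ++ₛ z ∉ V) :
    UCatS (starL K) V := by
  rintro _ v _ v' ⟨l, hl, rfl⟩ hv ⟨l', hl', rfl⟩ hv' h
  obtain ⟨rfl, rfl⟩ := hs.flatten_append_stream_inj hH hV hno hl hl' hv hv' h
  exact ⟨rfl, rfl⟩

theorem omegaL_inter_catS (hs : Sync H K) (hH : ∀ k ∈ K, HeadIn H k) (hne : [] ∉ K)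
    {V : Set (Stream' B)} (hV : ∀ v ∈ V, v.head ∈ H)
    (hno : ∀ k ∈ K, ∀ z : Stream' B, z.head ∈ H → k ++ₛ z ∉ V) :
    omegaL K ∩ catS (starL K) V = ∅ := by
  rw [Set.eq_empty_iff_forall_notMem]
  rintro x ⟨hx, _, v, ⟨l, hl, rfl⟩, hv, rfl⟩
  induction l with
  | nil =>
    obtain ⟨k, hk, y, hy, h⟩ := omegaL_step hx
    rw [List.flatten_nil, Stream'.nil_append_stream] at h
    exact hno k hk y (head_mem_of_mem_omegaL hH hne hy) (h ▸ hv)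
  | cons k l ih =>
    rw [List.forall_mem_cons] at hl
    obtain ⟨k', hk', y, hy, h⟩ := omegaL_step hx
    rw [List.flatten_cons, Stream'.append_append_stream] at h
    obtain ⟨-, h2⟩ := hs.append_stream_inj hl.1 hk' (head_flatten_append hH hl.2 (hV _ hv))
      (head_mem_of_mem_omegaL hH hne hy) h
    exact ih hl.2 (h2 ▸ hy)

theorem ocode (hs : Sync H K) (hH : ∀ k ∈ K, HeadIn H k) (hne : [] ∉ K) : OCode K := by
  rintro g g' x hg hg' ⟨W, hW0, hW⟩ ⟨W', hW0', hW'⟩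
  have hhead : ∀ n, (W n).head ∈ H := fun n => by
    rw [hW]
    exact (hH _ (hg n)).head_append (fun h => hne (h ▸ hg n)) _
  have hhead' : ∀ n, (W' n).head ∈ H := fun n => by
    rw [hW']
    exact (hH _ (hg' n)).head_append (fun h => hne (h ▸ hg' n)) _
  have key : ∀ n, W n = W' n := by
    intro n
    induction n with
    | zero => rw [hW0, hW0']
    | succ n ih =>
      rw [hW, hW'] at ih
      exact (hs.append_stream_inj (hg n) (hg' n) (hhead _) (hhead' _) ih).2
  refine Stream'.ext fun n => ?_
  have := key n
  rw [hW, hW'] at this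
  exact (hs.append_stream_inj (hg n) (hg' n) (hhead _) (hhead' _) this).1

end Sync

/-- Iterated extraction of a factor in `K` either goes on forever or ends in `V`. -/
theorem mem_omegaL_or_catS {K : Set (List B)} {V : Set (Stream' B)} (P : Stream' B → Prop)
    (hP : ∀ x, P x → x ∈ V ∨ ∃ k ∈ K, ∃ y, x = k ++ₛ y ∧ P y) {x : Stream' B} (hx : P x) :
    x ∈ omegaL K ∪ catS (starL K) V := by
  by_cases hxV : x ∈ catS (starL K) V
  · exact Or.inr hxV
  refine Or.inl (mem_omegaL_of_step (fun x => P x ∧ x ∉ catS (starL K) V) ?_ ⟨hx, hxV⟩)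
  rintro x ⟨hx, hxV⟩
  rcases hP x hx with h | ⟨k, hk, y, rfl, hy⟩
  · exact absurd ⟨[], x, ⟨[], by simp, rfl⟩, h, rfl⟩ hxV
  · refine ⟨k, hk, y, rfl, hy, ?_⟩
    rintro ⟨_, v, ⟨l, hl, rfl⟩, hv, rfl⟩
    refine hxV ⟨(k :: l).flatten, v, ⟨k :: l, ?_, rfl⟩, hv, ?_⟩
    · exact List.forall_mem_cons.mpr ⟨hk, hl⟩
    · rw [List.flatten_cons, Stream'.append_append_stream]

/-- Iterated extraction of a nonempty factor in `K` from a finite word ends in `V`. -/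
theorem mem_catL_star {K V : Set (List B)} (hne : [] ∉ K) (P : List B → Prop)
    (hP : ∀ w, P w → w ∈ V ∨ ∃ k ∈ K, ∃ y, w = k ++ y ∧ P y) {w : List B} (hw : P w) :
    w ∈ catL (starL K) V := by
  induction hn : w.length using Nat.strong_induction_on generalizing w with
  | _ n ih =>
    rcases hP w hw with h | ⟨k, hk, y, rfl, hy⟩
    · exact ⟨[], w, ⟨[], by simp, rfl⟩, h, rfl⟩
    · have hk0 : k ≠ [] := fun h => hne (h ▸ hk)
      have := List.length_pos_of_ne_nil hk0
      obtain ⟨_, v, ⟨l, hl, rfl⟩, hv, rfl⟩ :=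
        ih y.length (by rw [← hn, List.length_append]; omega) hy rfl
      refine ⟨(k :: l).flatten, v, ⟨k :: l, ?_, rfl⟩, hv, ?_⟩
      · exact List.forall_mem_cons.mpr ⟨hk, hl⟩
      · rw [List.flatten_cons, List.append_assoc]

variable {S : Type} [Monoid S]

/-- The value of a finite word. -/
def val (ψ : B → S) (w : List B) : S := (w.map ψ).prod

@[simp] theorem val_nil (ψ : B → S) : val ψ [] = 1 := rfl

@[simp] theorem val_cons (ψ : B → S) (b : B) (w : List B) : val ψ (b :: w) = ψ b * val ψ w := by
  simp [val]

@[simp] theorem val_append (ψ : B → S) (u v : List B) :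
    val ψ (u ++ v) = val ψ u * val ψ v := by
  simp [val]

theorem val_flatten (ψ : B → S) (l : List (List B)) :
    val ψ l.flatten = val id (l.map (val ψ)) := by
  induction l with
  | nil => rfl
  | cons u l ih => simp [ih]

/-- Languages denoted by good `ε`-free expressions, together with their value. -/
inductive GoodLang (ψ : B → S) : Set (List B) → S → Prop
  | empty (s : S) : GoodLang ψ ∅ s
  | letter (b : B) : GoodLang ψ {[b]} (ψ b)
  | union {L M : Set (List B)} {s : S} (hL : GoodLang ψ L s) (hM : GoodLang ψ M s)
      (h : L ∩ M = ∅) : GoodLang ψ (L ∪ M) s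
  | cat {L M : Set (List B)} {s t : S} (hL : GoodLang ψ L s) (hM : GoodLang ψ M t)
      (h : UCat L M) : GoodLang ψ (catL L M) (s * t)
  | plus {L : Set (List B)} {s : S} (hL : GoodLang ψ L s) (hs : s * s = s) (h : Code L) :
      GoodLang ψ (plusL L) s

/-- Disjoint unions of languages `F · G^ω` with `F` and `G` good. -/
inductive GoodOmega (ψ : B → S) : Set (Stream' B) → Prop
  | empty : GoodOmega ψ ∅
  | base {F G : Set (List B)} {s e : S} (hF : GoodLang ψ F s) (hG : GoodLang ψ G e)
      (he : e * e = e) (h : UCatS F (omegaL G)) (hc : OCode G) :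
      GoodOmega ψ (catS F (omegaL G))
  | union {X Y : Set (Stream' B)} (hX : GoodOmega ψ X) (hY : GoodOmega ψ Y) (h : X ∩ Y = ∅) :
      GoodOmega ψ (X ∪ Y)

/-- The nonempty words of `L` of value `s`. -/
def slice (ψ : B → S) (L : Set (List B)) (s : S) : Set (List B) :=
  {w | w ∈ L ∧ w ≠ [] ∧ val ψ w = s}

/-- Every slice of `L` is good. -/
def Reg (ψ : B → S) (L : Set (List B)) : Prop := ∀ s, GoodLang ψ (slice ψ L s) s

variable {ψ : B → S}

theorem val_flatten_of_idem {L : Set (List B)} {s : S} (hs : s * s = s)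
    (hL : ∀ w ∈ L, val ψ w = s) {l : List (List B)} (hne : l ≠ []) (hl : ∀ u ∈ l, u ∈ L) :
    val ψ l.flatten = s := by
  induction l with
  | nil => exact absurd rfl hne
  | cons u l ih =>
    rw [List.forall_mem_cons] at hl
    rw [List.flatten_cons, val_append, hL u hl.1]
    by_cases h : l = []
    · simp [h]
    · rw [ih h hl.2, hs]

theorem GoodLang.val_eq {L : Set (List B)} {s : S} (h : GoodLang ψ L s) :
    ∀ w ∈ L, val ψ w = s := by
  induction h with
  | empty s => exact fun w hw => hw.elim
  | letter b => rintro w rfl; simp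
  | union _ _ _ ih1 ih2 => exact fun w hw => hw.elim (ih1 w) (ih2 w)
  | cat _ _ _ ih1 ih2 =>
    rintro _ ⟨u, v, hu, hv, rfl⟩
    rw [val_append, ih1 u hu, ih2 v hv]
  | plus _ hs _ ih =>
    rintro _ ⟨l, hne, hl, rfl⟩
    exact val_flatten_of_idem hs ih hne hl

theorem GoodLang.nil_notMem {L : Set (List B)} {s : S} (h : GoodLang ψ L s) : [] ∉ L := by
  induction h with
  | empty s => exact fun h => h
  | letter b => exact fun h => by simp at h
  | union _ _ _ ih1 ih2 => exact fun h => h.elim ih1 ih2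
  | cat _ _ _ ih1 _ =>
    rintro ⟨u, v, hu, -, h⟩
    obtain ⟨rfl, -⟩ := List.append_eq_nil_iff.mp h.symm
    exact ih1 hu
  | plus _ _ _ ih =>
    rintro ⟨l, hne, hl, h⟩
    obtain ⟨u, l, rfl⟩ := List.exists_cons_of_ne_nil hne
    obtain ⟨rfl, -⟩ := List.append_eq_nil_iff.mp h.symm
    exact ih (hl _ List.mem_cons_self)

theorem GoodLang.biUnion {ι : Type} (I : Finset ι) (L : ι → Set (List B)) (s : S)
    (hL : ∀ i ∈ I, GoodLang ψ (L i) s)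
    (hd : ∀ i ∈ I, ∀ j ∈ I, ∀ w, w ∈ L i → w ∈ L j → i = j) :
    GoodLang ψ {w | ∃ i ∈ I, w ∈ L i} s := by
  classical
  induction I using Finset.induction_on with
  | empty => simpa using GoodLang.empty s
  | insert i I hi ih =>
    have h1 := ih (fun j hj => hL j (Finset.mem_insert_of_mem hj)) fun j hj k hk =>
      hd j (Finset.mem_insert_of_mem hj) k (Finset.mem_insert_of_mem hk)
    have h2 := GoodLang.union (hL i (Finset.mem_insert_self i I)) h1 (by
      rw [Set.eq_empty_iff_forall_notMem]
      rintro w ⟨hw, j, hj, hw'⟩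
      have := hd i (Finset.mem_insert_self i I) j (Finset.mem_insert_of_mem hj) w hw hw'
      exact hi (this ▸ hj))
    convert h2 using 1
    ext w
    simp

theorem GoodOmega.biUnion {ι : Type} (I : Finset ι) (X : ι → Set (Stream' B))
    (hX : ∀ i ∈ I, GoodOmega ψ (X i))
    (hd : ∀ i ∈ I, ∀ j ∈ I, ∀ w, w ∈ X i → w ∈ X j → i = j) :
    GoodOmega ψ {w | ∃ i ∈ I, w ∈ X i} := by
  classical
  induction I using Finset.induction_on with
  | empty => simpa using GoodOmega.empty
  | insert i I hi ih =>
    have h1 := ih (fun j hj => hX j (Finset.mem_insert_of_mem hj)) fun j hj k hk =>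
      hd j (Finset.mem_insert_of_mem hj) k (Finset.mem_insert_of_mem hk)
    have h2 := GoodOmega.union (hX i (Finset.mem_insert_self i I)) h1 (by
      rw [Set.eq_empty_iff_forall_notMem]
      rintro w ⟨hw, j, hj, hw'⟩
      have := hd i (Finset.mem_insert_self i I) j (Finset.mem_insert_of_mem hj) w hw hw'
      exact hi (this ▸ hj))
    convert h2 using 1
    ext w
    simp

theorem GoodLang.reg {L : Set (List B)} {s : S} (h : GoodLang ψ L s) : Reg ψ L := by
  intro t
  by_cases hst : s = t
  · subst hst
    convert h using 1
    ext w
    exact ⟨fun hw => hw.1, fun hw => ⟨hw, fun e => h.nil_notMem (e ▸ hw), h.val_eq w hw⟩⟩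
  · convert GoodLang.empty t using 1
    rw [Set.eq_empty_iff_forall_notMem]
    rintro w ⟨hw, -, rfl⟩
    exact hst (h.val_eq w hw).symm

theorem Reg.goodLang {L : Set (List B)} {s : S} (h : Reg ψ L) (hne : [] ∉ L)
    (hs : ∀ w ∈ L, val ψ w = s) : GoodLang ψ L s := by
  convert h s using 1
  ext w
  exact ⟨fun hw => ⟨hw, fun e => hne (e ▸ hw), hs w hw⟩, fun hw => hw.1⟩

theorem Reg.congr {L M : Set (List B)} (h : Reg ψ L) (hLM : ∀ w, w ≠ [] → (w ∈ L ↔ w ∈ M)) :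
    Reg ψ M := by
  intro s
  convert h s using 1
  ext w
  exact ⟨fun hw => ⟨(hLM w hw.2.1).mpr hw.1, hw.2⟩, fun hw => ⟨(hLM w hw.2.1).mp hw.1, hw.2⟩⟩

theorem Reg.union {L M : Set (List B)} (hL : Reg ψ L) (hM : Reg ψ M) (h : L ∩ M = ∅) :
    Reg ψ (L ∪ M) := by
  intro s
  convert (hL s).union (hM s) ?_ using 1
  · ext w
    simp only [slice, Set.mem_union, Set.mem_ofPred_eq]
    tauto
  · rw [Set.eq_empty_iff_forall_notMem] at h ⊢
    exact fun w hw => h w ⟨hw.1.1, hw.2.1⟩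

theorem Reg.restrict {L : Set (List B)} (hL : Reg ψ L) (Z : Set S) :
    Reg ψ {w | w ∈ L ∧ val ψ w ∈ Z} := by
  intro s
  by_cases hs : s ∈ Z
  · convert hL s using 1
    ext w
    exact ⟨fun hw => ⟨hw.1.1, hw.2⟩, fun hw => ⟨⟨hw.1, hw.2.2 ▸ hs⟩, hw.2⟩⟩
  · convert GoodLang.empty s using 1
    rw [Set.eq_empty_iff_forall_notMem]
    rintro w ⟨hw, -, rfl⟩
    exact hs hw.2

theorem UCat.mono {L M L' M' : Set (List B)} (h : UCat L M) (hL : L' ⊆ L) (hM : M' ⊆ M) :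
    UCat L' M' :=
  fun _ _ _ _ hu hv hu' hv' => h _ _ _ _ (hL hu) (hM hv) (hL hu') (hM hv')

theorem UCatS.mono {L L' : Set (List B)} {X X' : Set (Stream' B)} (h : UCatS L X) (hL : L' ⊆ L)
    (hX : X' ⊆ X) : UCatS L' X' :=
  fun _ _ _ _ hu hv hu' hv' => h _ _ _ _ (hL hu) (hX hv) (hL hu') (hX hv')

theorem Reg.cat [Fintype S] {L M : Set (List B)} (hL : Reg ψ L) (hM : Reg ψ M) (h : UCat L M) :
    Reg ψ (catL L M) := by
  classical
  intro s
  have hsl : ∀ (N : Set (List B)) p, slice ψ N p ⊆ N := fun N p w hw => hw.1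
  have h1 : GoodLang ψ {w | ∃ i ∈ (Finset.univ : Finset (S × S)).filter (fun i => i.1 * i.2 = s),
      w ∈ catL (slice ψ L i.1) (slice ψ M i.2)} s := by
    refine GoodLang.biUnion _ _ _ ?_ ?_
    · rintro ⟨p, q⟩ hi
      obtain rfl := (Finset.mem_filter.mp hi).2
      exact (hL p).cat (hM q) (h.mono (hsl _ _) (hsl _ _))
    · rintro ⟨p, q⟩ - ⟨p', q'⟩ - w ⟨u, v, hu, hv, rfl⟩ ⟨u', v', hu', hv', e⟩
      obtain ⟨rfl, rfl⟩ := h _ _ _ _ hu.1 hv.1 hu'.1 hv'.1 e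
      exact Prod.ext (hu.2.2.symm.trans hu'.2.2) (hv.2.2.symm.trans hv'.2.2)
  have h2 : GoodLang ψ {w | w ∈ slice ψ L s ∧ [] ∈ M} s := by
    by_cases hn : [] ∈ M
    · simpa [hn] using hL s
    · simpa [hn] using GoodLang.empty s
  have h3 : GoodLang ψ {w | w ∈ slice ψ M s ∧ [] ∈ L} s := by
    by_cases hn : [] ∈ L
    · simpa [hn] using hM s
    · simpa [hn] using GoodLang.empty s
  convert (h1.union h2 ?_).union h3 ?_ using 1
  · ext w
    constructor
    · rintro ⟨⟨u, v, hu, hv, rfl⟩, hne, rfl⟩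
      by_cases hu0 : u = []
      · subst hu0
        exact Or.inr ⟨⟨hv, hne, by simp⟩, hu⟩
      by_cases hv0 : v = []
      · subst hv0
        exact Or.inl (Or.inr ⟨⟨by simpa using hu, hne, rfl⟩, hv⟩)
      · exact Or.inl (Or.inl ⟨(val ψ u, val ψ v), by simp,
          u, v, ⟨hu, hu0, rfl⟩, ⟨hv, hv0, rfl⟩, rfl⟩)
    · rintro ((⟨⟨p, q⟩, hi, u, v, hu, hv, rfl⟩ | ⟨hw, hn⟩) | ⟨hw, hn⟩)
      · refine ⟨⟨u, v, hu.1, hv.1, rfl⟩, fun e => hu.2.1 (List.append_eq_nil_iff.mp e).1, ?_⟩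
        rw [val_append, hu.2.2, hv.2.2]
        exact (Finset.mem_filter.mp hi).2
      · exact ⟨⟨w, [], hw.1, hn, by simp⟩, hw.2⟩
      · exact ⟨⟨[], w, hn, hw.1, rfl⟩, hw.2⟩
  · rw [Set.eq_empty_iff_forall_notMem]
    rintro _ ⟨⟨i, -, u, v, hu, hv, rfl⟩, hw, hn⟩
    exact hv.2.1 (h _ _ _ [] hu.1 hv.1 hw.1 hn (by simp)).2
  · rw [Set.eq_empty_iff_forall_notMem]
    rintro w ⟨⟨i, -, u, v, hu, hv, rfl⟩ | ⟨hw, hn⟩, hw', hn'⟩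
    · exact hu.2.1 (h _ _ [] _ hu.1 hv.1 hn' hw'.1 rfl).1
    · exact hw.2.1 (h _ _ [] _ hw.1 hn hn' hw'.1 (by simp)).1

theorem catS_catL (L M : Set (List B)) (X : Set (Stream' B)) :
    catS (catL L M) X = catS L (catS M X) := by
  ext x
  constructor
  · rintro ⟨_, y, ⟨u, v, hu, hv, rfl⟩, hy, rfl⟩
    exact ⟨u, v ++ₛ y, hu, ⟨v, y, hv, hy, rfl⟩, Stream'.append_append_stream _ _ _⟩
  · rintro ⟨u, _, hu, ⟨v, y, hv, hy, rfl⟩, rfl⟩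
    exact ⟨u ++ v, y, ⟨u, v, hu, hv, rfl⟩, hy, (Stream'.append_append_stream _ _ _).symm⟩

theorem catS_union (L : Set (List B)) (X Y : Set (Stream' B)) :
    catS L (X ∪ Y) = catS L X ∪ catS L Y := by
  ext x
  constructor
  · rintro ⟨u, y, hu, hy | hy, rfl⟩
    exacts [Or.inl ⟨u, y, hu, hy, rfl⟩, Or.inr ⟨u, y, hu, hy, rfl⟩]
  · rintro (⟨u, y, hu, hy, rfl⟩ | ⟨u, y, hu, hy, rfl⟩)
    exacts [⟨u, y, hu, Or.inl hy, rfl⟩, ⟨u, y, hu, Or.inr hy, rfl⟩]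

theorem GoodLang.catS {L : Set (List B)} {X : Set (Stream' B)} {s : S} (hL : GoodLang ψ L s)
    (hX : GoodOmega ψ X) (h : UCatS L X) : GoodOmega ψ (catS L X) := by
  induction hX with
  | empty =>
    convert GoodOmega.empty using 1
    rw [Set.eq_empty_iff_forall_notMem]
    rintro _ ⟨_, _, _, hy, _⟩
    exact hy
  | @base F G t e hF hG he hFG hc =>
    by_cases hn : (omegaL G).Nonempty
    · obtain ⟨z, hz⟩ := hn
      rw [← catS_catL]
      refine GoodOmega.base (hL.cat hF ?_) hG he ?_ hc
      · intro u v u' v' hu hv hu' hv' e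
        have := h u (v ++ₛ z) u' (v' ++ₛ z) hu ⟨v, z, hv, hz, rfl⟩ hu' ⟨v', z, hv', hz, rfl⟩
          (by rw [← Stream'.append_append_stream, e, Stream'.append_append_stream])
        exact ⟨this.1, (hFG _ _ _ _ hv hz hv' hz this.2).1⟩
      · rintro _ x _ x' ⟨u, v, hu, hv, rfl⟩ hx ⟨u', v', hu', hv', rfl⟩ hx' e
        rw [Stream'.append_append_stream, Stream'.append_append_stream] at e
        obtain ⟨rfl, e'⟩ := h _ _ _ _ hu ⟨v, x, hv, hx, rfl⟩ hu' ⟨v', x', hv', hx', rfl⟩ e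
        obtain ⟨rfl, rfl⟩ := hFG _ _ _ _ hv hx hv' hx' e'
        exact ⟨rfl, rfl⟩
    · convert GoodOmega.empty using 1
      rw [Set.eq_empty_iff_forall_notMem]
      rintro _ ⟨_, _, _, ⟨_, z, _, hz, _⟩, _⟩
      exact hn ⟨z, hz⟩
  | @union X Y _ _ hXY ih1 ih2 =>
    rw [catS_union]
    refine (ih1 (h.mono subset_rfl Set.subset_union_left)).union
      (ih2 (h.mono subset_rfl Set.subset_union_right)) ?_
    rw [Set.eq_empty_iff_forall_notMem]
    rintro _ ⟨⟨u, x, hu, hx, rfl⟩, u', y, hu', hy, e⟩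
    obtain ⟨rfl, rfl⟩ := h _ _ _ _ hu (Or.inl hx) hu' (Or.inr hy) e
    exact (Set.eq_empty_iff_forall_notMem.mp hXY) x ⟨hx, hy⟩

theorem Reg.catS [Fintype S] {L : Set (List B)} {X : Set (Stream' B)} (hL : Reg ψ L)
    (hX : GoodOmega ψ X) (h : UCatS L X) : GoodOmega ψ (OmegaRat.catS L X) := by
  have h1 : GoodOmega ψ {w | ∃ s ∈ (Finset.univ : Finset S),
      w ∈ OmegaRat.catS (slice ψ L s) X} := by
    refine GoodOmega.biUnion _ _ ?_ ?_
    · exact fun s _ => (hL s).catS hX (h.mono (fun w hw => hw.1) subset_rfl)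
    · rintro s - t - _ ⟨u, x, hu, hx, rfl⟩ ⟨u', x', hu', hx', e⟩
      obtain ⟨rfl, rfl⟩ := h _ _ _ _ hu.1 hx hu'.1 hx' e
      exact hu.2.2.symm.trans hu'.2.2
  by_cases hn : [] ∈ L
  · convert h1.union hX ?_ using 1
    · ext w
      constructor
      · rintro ⟨u, x, hu, hx, rfl⟩
        by_cases hu0 : u = []
        · subst hu0
          exact Or.inr hx
        · exact Or.inl ⟨val ψ u, Finset.mem_univ _, u, x, ⟨hu, hu0, rfl⟩, hx, rfl⟩
      · rintro (⟨s, -, u, x, hu, hx, rfl⟩ | hw)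
        · exact ⟨u, x, hu.1, hx, rfl⟩
        · exact ⟨[], w, hn, hw, rfl⟩
    · rw [Set.eq_empty_iff_forall_notMem]
      rintro _ ⟨⟨s, -, u, x, hu, hx, rfl⟩, hw⟩
      exact hu.2.1 (h _ _ [] _ hu.1 hx hn hw rfl).1
  · convert h1 using 1
    ext w
    constructor
    · rintro ⟨u, x, hu, hx, rfl⟩
      exact ⟨val ψ u, Finset.mem_univ _, u, x, ⟨hu, fun e => hn (e ▸ hu), rfl⟩, hx, rfl⟩
    · rintro ⟨s, -, u, x, hu, hx, rfl⟩
      exact ⟨u, x, hu.1, hx, rfl⟩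

/-- Substitution of the slices of `K` for letters in a language over the alphabet `S`. -/
def subL (ψ : B → S) (K : Set (List B)) (L : Set (List S)) : Set (List B) :=
  {w | ∃ l : List (List B), (∀ u ∈ l, u ∈ K) ∧ l.map (val ψ) ∈ L ∧ w = l.flatten}

/-- Substitution of the slices of `K` for letters in a set of infinite words over `S`. -/
def subS (ψ : B → S) (K : Set (List B)) (X : Set (Stream' S)) : Set (Stream' B) :=
  {x | ∃ g : Stream' (List B), (∀ n, g.get n ∈ K) ∧ Stream'.map (val ψ) g ∈ X ∧ InfCat g x}

theorem exists_flatten_of_map_eq_flatten {C D : Type} {f : C → D} {l : List C}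
    {ls : List (List D)} (h : l.map f = ls.flatten) :
    ∃ m : List (List C), m.map (List.map f) = ls ∧ l = m.flatten := by
  induction ls generalizing l with
  | nil => exact ⟨[], rfl, by simpa using h⟩
  | cons a ls ih =>
    rw [List.flatten_cons] at h
    obtain ⟨l₁, l₂, rfl, h1, h2⟩ := List.map_eq_append_iff.mp h
    obtain ⟨m, hm, rfl⟩ := ih h2
    exact ⟨l₁ :: m, by simp [h1, hm], by simp⟩

theorem exists_map_of_forall {C D : Type} {f : C → D} {P : C → Prop} {l : List D}
    (h : ∀ u ∈ l, ∃ x, P x ∧ u = f x) : ∃ m : List C, (∀ x ∈ m, P x) ∧ l = m.map f := by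
  induction l with
  | nil => exact ⟨[], by simp, rfl⟩
  | cons a l ih =>
    rw [List.forall_mem_cons] at h
    obtain ⟨m, hm, rfl⟩ := ih h.2
    obtain ⟨x, hx, rfl⟩ := h.1
    exact ⟨x :: m, List.forall_mem_cons.mpr ⟨hx, hm⟩, rfl⟩

theorem exists_append_of_map_eq_append {C D : Type} {f : C → D} {g : Stream' C} {u : List D}
    {y : Stream' D} (h : Stream'.map f g = u ++ₛ y) :
    ∃ l g', g = l ++ₛ g' ∧ l.map f = u ∧ Stream'.map f g' = y := by
  induction u generalizing g with
  | nil => exact ⟨[], g, rfl, rfl, h⟩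
  | cons a u ih =>
    rw [Stream'.map_eq, Stream'.cons_append_stream] at h
    obtain ⟨h1, h2⟩ := Stream'.cons_injective2 h
    obtain ⟨l, g', hg, rfl, rfl⟩ := ih h2
    refine ⟨g.head :: l, g', ?_, by simp [h1], rfl⟩
    rw [Stream'.cons_append_stream, ← hg, Stream'.eta]

theorem forall_get_append {C : Type} {P : C → Prop} {l : List C} {g : Stream' C} :
    (∀ n, P ((l ++ₛ g).get n)) ↔ (∀ u ∈ l, P u) ∧ ∀ n, P (g.get n) := by
  induction l with
  | nil => simp
  | cons a l ih =>
    rw [List.forall_mem_cons, and_assoc, ← ih, Stream'.cons_append_stream]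
    exact ⟨fun h => ⟨h 0, fun n => h (n + 1)⟩, fun h n => Nat.casesOn n h.1 h.2⟩

theorem InfCat.forall_mem {C : Type} {P : C → Prop} {l : Stream' (List C)} {h : Stream' C}
    (hl : InfCat l h) (hP : ∀ n, P (h.get n)) : ∀ n, ∀ u ∈ l.get n, P u := by
  obtain ⟨W, rfl, hW⟩ := hl
  have key : ∀ m n, P ((W m).get n) := by
    intro m
    induction m with
    | zero => exact hP
    | succ m ih =>
      rw [hW] at ih
      exact (forall_get_append.mp ih).2
  intro m
  have := key m
  rw [hW] at this
  exact (forall_get_append.mp this).1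

theorem InfCat.forall_get {C : Type} {P : C → Prop} {l : Stream' (List C)} {h : Stream' C}
    (hl : InfCat l h) (hne : ∀ n, l.get n ≠ []) (hP : ∀ n, ∀ u ∈ l.get n, P u) :
    ∀ n, P (h.get n) := by
  obtain ⟨W, rfl, hW⟩ := hl
  suffices ∀ n m, P ((W m).get n) from fun n => this n 0
  intro n
  induction n using Nat.strong_induction_on with
  | _ n ih =>
    intro m
    rw [hW]
    by_cases hn : n < (l.get m).length
    · rw [Stream'.get_append_left _ _ _ hn]
      exact hP m _ (List.getElem_mem hn)
    · obtain ⟨j, rfl⟩ := Nat.exists_eq_add_of_le (not_lt.mp hn)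
      rw [Stream'.get_append_right]
      have := List.length_pos_of_ne_nil (hne m)
      exact ih j (by omega) _

/-- A factorization of the image of `h` lifts to a factorization of `h`. -/
theorem InfCat.lift {C D : Type} {f : C → D} {h : Stream' C} {gg : Stream' (List D)}
    (hg : InfCat gg (Stream'.map f h)) :
    ∃ l : Stream' (List C), InfCat l h ∧ Stream'.map (List.map f) l = gg := by
  obtain ⟨W, hW0, hW⟩ := hg
  let pos : ℕ → ℕ := fun n => Nat.rec 0 (fun n p => p + (gg.get n).length) n
  have hmap : ∀ n, Stream'.map f (h.drop (pos n)) = W n := by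
    intro n
    induction n with
    | zero => exact hW0.symm
    | succ n ih =>
      have e : h.drop (pos (n + 1)) = (h.drop (pos n)).drop (gg.get n).length := by
        rw [Stream'.drop_drop]
      rw [e, ← Stream'.drop_map, ih, hW, Stream'.drop_append_stream]
  refine ⟨fun n => (h.drop (pos n)).take (gg.get n).length,
    ⟨fun n => h.drop (pos n), rfl, fun n => ?_⟩, Stream'.ext fun n => ?_⟩
  · have e : h.drop (pos (n + 1)) = (h.drop (pos n)).drop (gg.get n).length := by
      rw [Stream'.drop_drop]
    change h.drop (pos n) = (h.drop (pos n)).take (gg.get n).length ++ₛ h.drop (pos (n + 1))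
    rw [e]
    exact (Stream'.append_take_drop _ _).symm
  · change List.map f ((h.drop (pos n)).take (gg.get n).length) = _
    rw [Stream'.map_take, hmap, hW, Stream'.take_append_of_le_length _ _ _ le_rfl,
      List.take_length]

section Substitution

variable {K : Set (List B)}

theorem subL_catL (L M : Set (List S)) :
    subL ψ K (catL L M) = catL (subL ψ K L) (subL ψ K M) := by
  ext w
  constructor
  · rintro ⟨l, hl, ⟨u, v, hu, hv, e⟩, rfl⟩
    obtain ⟨l₁, l₂, rfl, rfl, rfl⟩ := List.map_eq_append_iff.mp e
    rw [List.forall_mem_append] at hl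
    exact ⟨_, _, ⟨l₁, hl.1, hu, rfl⟩, ⟨l₂, hl.2, hv, rfl⟩, by simp⟩
  · rintro ⟨_, _, ⟨l₁, h1, hu, rfl⟩, ⟨l₂, h2, hv, rfl⟩, rfl⟩
    exact ⟨l₁ ++ l₂, List.forall_mem_append.mpr ⟨h1, h2⟩, ⟨_, _, hu, hv, by simp⟩, by simp⟩

theorem subL_plusL (L : Set (List S)) : subL ψ K (plusL L) = plusL (subL ψ K L) := by
  ext w
  constructor
  · rintro ⟨l, hl, ⟨ls, hne, hls, e⟩, rfl⟩
    obtain ⟨m, rfl, rfl⟩ := exists_flatten_of_map_eq_flatten e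
    refine ⟨m.map List.flatten, by simpa using hne, ?_, List.flatten_flatten⟩
    rw [List.forall_mem_map]
    intro x hx
    exact ⟨x, fun u hu => hl u (List.mem_flatten_of_mem hx hu),
      hls _ (List.mem_map_of_mem hx), rfl⟩
  · rintro ⟨ls, hne, hls, rfl⟩
    obtain ⟨m, hm, rfl⟩ := exists_map_of_forall
      (P := fun l : List (List B) => (∀ u ∈ l, u ∈ K) ∧ l.map (val ψ) ∈ L)
      (f := List.flatten) fun u hu => by
        obtain ⟨l, h1, h2, h3⟩ := hls u hu
        exact ⟨l, ⟨h1, h2⟩, h3⟩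
    refine ⟨m.flatten, ?_, ⟨m.map (List.map (val ψ)), by simpa using hne, ?_, ?_⟩,
      List.flatten_flatten.symm⟩
    · intro u hu
      obtain ⟨x, hx, hux⟩ := List.mem_flatten.mp hu
      exact (hm x hx).1 u hux
    · rw [List.forall_mem_map]
      exact fun x hx => (hm x hx).2
    · exact List.map_flatten

theorem ucat_subL (hc : Code K) {L M : Set (List S)} (h : UCat L M) :
    UCat (subL ψ K L) (subL ψ K M) := by
  rintro _ _ _ _ ⟨l₁, h1, hu, rfl⟩ ⟨l₂, h2, hv, rfl⟩ ⟨m₁, h1', hu', rfl⟩ ⟨m₂, h2', hv', rfl⟩ e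
  rw [← List.flatten_append, ← List.flatten_append] at e
  have e1 := hc _ _ (List.forall_mem_append.mpr ⟨h1, h2⟩) (List.forall_mem_append.mpr ⟨h1', h2'⟩) e
  have e2 := congrArg (List.map (val ψ)) e1
  rw [List.map_append, List.map_append] at e2
  have e3 := congrArg List.length (h _ _ _ _ hu hv hu' hv' e2).1
  rw [List.length_map, List.length_map] at e3
  obtain ⟨rfl, rfl⟩ := List.append_inj e1 e3
  exact ⟨rfl, rfl⟩

theorem code_subL (hc : Code K) {L : Set (List S)} (h : Code L) : Code (subL ψ K L) := by
  intro ls ls' hls hls' e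
  have lift : ∀ ls : List (List B), (∀ u ∈ ls, u ∈ subL ψ K L) → ∃ m : List (List (List B)),
      (∀ x ∈ m, (∀ u ∈ x, u ∈ K) ∧ x.map (val ψ) ∈ L) ∧ ls = m.map List.flatten := by
    intro ls hls
    refine exists_map_of_forall fun u hu => ?_
    obtain ⟨l, h1, h2, h3⟩ := hls u hu
    exact ⟨l, ⟨h1, h2⟩, h3⟩
  have hflat : ∀ m : List (List (List B)),
      (∀ x ∈ m, (∀ u ∈ x, u ∈ K) ∧ x.map (val ψ) ∈ L) → ∀ u ∈ m.flatten, u ∈ K := by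
    intro m hm u hu
    obtain ⟨x, hx, hux⟩ := List.mem_flatten.mp hu
    exact (hm x hx).1 u hux
  obtain ⟨m, hm, rfl⟩ := lift ls hls
  obtain ⟨m', hm', rfl⟩ := lift ls' hls'
  rw [← List.flatten_flatten, ← List.flatten_flatten] at e
  have e1 := hc _ _ (hflat m hm) (hflat m' hm') e
  have e2 := congrArg (List.map (val ψ)) e1
  rw [List.map_flatten, List.map_flatten] at e2
  have e3 := h _ _ (by simpa using fun x hx => (hm x hx).2)
    (by simpa using fun x hx => (hm' x hx).2) e2
  have e4 := congrArg (List.map List.length) e3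
  simp only [List.map_map] at e4
  have e5 : m = m' := List.eq_iff_flatten_eq.mpr ⟨e1, by simpa [Function.comp_def] using e4⟩
  rw [e5]

theorem GoodLang.sub (hK : Reg ψ K) (hne : [] ∉ K) (hc : Code K) {L : Set (List S)} {s : S}
    (hL : GoodLang id L s) : GoodLang ψ (subL ψ K L) s := by
  induction hL with
  | empty s =>
    convert GoodLang.empty s using 1
    rw [Set.eq_empty_iff_forall_notMem]
    rintro _ ⟨_, _, h, _⟩
    exact h
  | letter b =>
    suffices e : subL ψ K {[b]} = slice ψ K b from e ▸ hK b
    ext w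
    constructor
    · rintro ⟨l, hl, h, rfl⟩
      obtain ⟨u, rfl, hu⟩ := List.map_eq_singleton_iff.mp h
      have huK : u ∈ K := hl u (by simp)
      rw [List.flatten_singleton]
      exact ⟨huK, ne_of_mem_of_not_mem huK hne, hu⟩
    · rintro ⟨hw, -, rfl⟩
      exact ⟨[w], by simpa using hw, by simp, by simp⟩
  | @union L M s _ _ h ih1 ih2 =>
    convert ih1.union ih2 ?_ using 1
    · ext w
      constructor
      · rintro ⟨l, hl, h | h, rfl⟩
        exacts [Or.inl ⟨l, hl, h, rfl⟩, Or.inr ⟨l, hl, h, rfl⟩]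
      · rintro (⟨l, hl, h, rfl⟩ | ⟨l, hl, h, rfl⟩)
        exacts [⟨l, hl, Or.inl h, rfl⟩, ⟨l, hl, Or.inr h, rfl⟩]
    · rw [Set.eq_empty_iff_forall_notMem] at h ⊢
      rintro _ ⟨⟨l, hl, hw, rfl⟩, l', hl', hw', e⟩
      obtain rfl := hc _ _ hl hl' e
      exact h _ ⟨hw, hw'⟩
  | cat _ _ h ih1 ih2 =>
    rw [subL_catL]
    exact ih1.cat ih2 (ucat_subL hc h)
  | plus _ hs h ih =>
    rw [subL_plusL]
    exact ih.plus hs (code_subL hc h)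

theorem Reg.sub (hK : Reg ψ K) (hne : [] ∉ K) (hc : Code K) {L : Set (List S)}
    (hL : Reg id L) : Reg ψ (subL ψ K L) := by
  intro s
  convert (hL s).sub hK hne hc using 1
  ext w
  constructor
  · rintro ⟨⟨l, hl, h, rfl⟩, hw, rfl⟩
    refine ⟨l, hl, ⟨h, ?_, (val_flatten ψ l).symm⟩, rfl⟩
    rintro e
    rw [List.map_eq_nil_iff] at e
    subst e
    exact hw rfl
  · rintro ⟨l, hl, ⟨h, hl0, rfl⟩, rfl⟩
    refine ⟨⟨l, hl, h, rfl⟩, ?_, val_flatten ψ l⟩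
    intro e
    cases l with
    | nil => exact hl0 rfl
    | cons u l =>
      have := hl u List.mem_cons_self
      rw [(List.append_eq_nil_iff.mp e).1] at this
      exact hne this

theorem subS_catS (L : Set (List S)) (X : Set (Stream' S)) :
    subS ψ K (catS L X) = catS (subL ψ K L) (subS ψ K X) := by
  ext x
  constructor
  · rintro ⟨g, hg, ⟨u, y, hu, hy, e⟩, hx⟩
    obtain ⟨l, g', rfl, rfl, rfl⟩ := exists_append_of_map_eq_append e
    obtain ⟨z, rfl, hz⟩ := hx.split
    obtain ⟨h1, h2⟩ := forall_get_append.mp hg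
    exact ⟨_, z, ⟨l, h1, hu, rfl⟩, ⟨g', h2, hy, hz⟩, rfl⟩
  · rintro ⟨_, z, ⟨l, h1, hu, rfl⟩, ⟨g', h2, hy, hz⟩, rfl⟩
    exact ⟨l ++ₛ g', forall_get_append.mpr ⟨h1, h2⟩,
      ⟨_, _, hu, hy, Stream'.map_append_stream _ _ _⟩, hz.append⟩

theorem subS_omegaL {G : Set (List S)} (hG : [] ∉ G) :
    subS ψ K (omegaL G) = omegaL (subL ψ K G) := by
  ext x
  constructor
  · rintro ⟨h, hh, ⟨gg, hgg, hc⟩, hx⟩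
    obtain ⟨l, hl, rfl⟩ := hc.lift
    exact ⟨_, fun n => ⟨l.get n, hl.forall_mem hh n, hgg n, rfl⟩, hl.flatten hx⟩
  · rintro ⟨gg, hgg, hx⟩
    choose l h1 h2 h3 using hgg
    have hne : ∀ n, Stream'.get l n ≠ [] := fun n e => hG (by
      have := h2 n
      rwa [show l n = [] from e] at this)
    obtain ⟨h, hh⟩ := exists_infCat l hne
    have hgg : gg = Stream'.map List.flatten l := Stream'.ext h3
    subst hgg
    exact ⟨h, hh.forall_get hne h1, ⟨_, fun n => h2 n, hh.map (val ψ)⟩, hh.unflatten hne hx⟩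

theorem ucatS_subL (ho : OCode K) {L : Set (List S)} {X : Set (Stream' S)} (h : UCatS L X) :
    UCatS (subL ψ K L) (subS ψ K X) := by
  rintro _ x _ x' ⟨l, hl, hu, rfl⟩ ⟨g, hg, hgX, hx⟩ ⟨l', hl', hu', rfl⟩ ⟨g', hg', hgX', hx'⟩ e
  have e1 := ho _ _ _ (forall_get_append.mpr ⟨hl, hg⟩) (forall_get_append.mpr ⟨hl', hg'⟩)
    hx.append (e ▸ hx'.append)
  have e2 := congrArg (Stream'.map (val ψ)) e1
  rw [Stream'.map_append_stream, Stream'.map_append_stream] at e2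
  have e3 := congrArg List.length (h _ _ _ _ hu hgX hu' hgX' e2).1
  rw [List.length_map, List.length_map] at e3
  obtain rfl := Stream'.append_left_injective _ _ _ _ e1 e3
  exact ⟨rfl, Stream'.append_right_injective _ _ _ e⟩

theorem ocode_subL (ho : OCode K) {G : Set (List S)} (hG : [] ∉ G) (h : OCode G) :
    OCode (subL ψ K G) := by
  intro gg gg' x hgg hgg' hx hx'
  have lift : ∀ gg : Stream' (List B), (∀ n, gg.get n ∈ subL ψ K G) → InfCat gg x →
      ∃ (l : Stream' (List (List B))) (h : Stream' (List B)), (∀ n, (l.get n).map (val ψ) ∈ G) ∧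
        gg = Stream'.map List.flatten l ∧ InfCat l h ∧ (∀ n, h.get n ∈ K) ∧ InfCat h x := by
    intro gg hgg hx
    choose l h1 h2 h3 using hgg
    have hne : ∀ n, Stream'.get l n ≠ [] := fun n e => hG (by
      have := h2 n
      rwa [show l n = [] from e] at this)
    obtain ⟨h, hh⟩ := exists_infCat l hne
    have hgg : gg = Stream'.map List.flatten l := Stream'.ext h3
    exact ⟨l, h, h2, hgg, hh, hh.forall_get hne h1, hh.unflatten hne (hgg ▸ hx)⟩
  obtain ⟨l, k, hl, rfl, hlk, hk, hkx⟩ := lift gg hgg hx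
  obtain ⟨l', k', hl', rfl, hlk', hk', hkx'⟩ := lift gg' hgg' hx'
  obtain rfl := ho _ _ _ hk hk' hkx hkx'
  have e := h _ _ _ (fun n => hl n) (fun n => hl' n) (hlk.map (val ψ)) (hlk'.map (val ψ))
  have e2 : l = l' := hlk.eq_of_length hlk' fun n => by
    have : ((l.get n).map (val ψ)).length = ((l'.get n).map (val ψ)).length :=
      congrArg (fun z => (Stream'.get z n).length) e
    simpa using this
  rw [e2]

theorem GoodOmega.sub (hK : Reg ψ K) (hne : [] ∉ K) (hc : Code K) (ho : OCode K)
    {X : Set (Stream' S)} (hX : GoodOmega id X) : GoodOmega ψ (subS ψ K X) := by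
  induction hX with
  | empty =>
    convert GoodOmega.empty using 1
    rw [Set.eq_empty_iff_forall_notMem]
    rintro _ ⟨_, _, h, _⟩
    exact h
  | base hF hG he h hoc =>
    rw [subS_catS, subS_omegaL hG.nil_notMem]
    refine GoodOmega.base (hF.sub hK hne hc) (hG.sub hK hne hc) he ?_
      (ocode_subL ho hG.nil_notMem hoc)
    rw [← subS_omegaL hG.nil_notMem]
    exact ucatS_subL ho h
  | @union X Y _ _ h ih1 ih2 =>
    convert ih1.union ih2 ?_ using 1
    · ext w
      constructor
      · rintro ⟨l, hl, h | h, hx⟩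
        exacts [Or.inl ⟨l, hl, h, hx⟩, Or.inr ⟨l, hl, h, hx⟩]
      · rintro (⟨l, hl, h, hx⟩ | ⟨l, hl, h, hx⟩)
        exacts [⟨l, hl, Or.inl h, hx⟩, ⟨l, hl, Or.inr h, hx⟩]
    · rw [Set.eq_empty_iff_forall_notMem] at h ⊢
      rintro x ⟨⟨g, hg, hgX, hx⟩, g', hg', hgX', hx'⟩
      obtain rfl := ho _ _ _ hg hg' hx hx'
      exact h _ ⟨hgX, hgX'⟩

end Substitution

/-- The words of length one over `D`. -/
def letters (D : Set B) : Set (List B) := {w | ∃ b ∈ D, w = [b]}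

/-- The finite words over `D`. -/
def words (D : Set B) : Set (List B) := {w | ∀ b ∈ w, b ∈ D}

/-- The infinite words over `D`. -/
def infWords (D : Set B) : Set (Stream' B) := {x | ∀ n, x.get n ∈ D}

theorem reg_letters [Fintype B] (D : Set B) : Reg ψ (letters D) := by
  classical
  intro s
  have h : GoodLang ψ {w | ∃ b ∈ Finset.univ.filter (fun b => b ∈ D ∧ ψ b = s), w ∈ ({[b]} :
      Set (List B))} s := by
    refine GoodLang.biUnion _ _ _ ?_ ?_
    · intro b hb
      rw [Finset.mem_filter] at hb
      obtain ⟨-, -, rfl⟩ := hb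
      exact GoodLang.letter b
    · rintro b - b' - _ rfl h
      exact List.singleton_injective h
  convert h using 1
  ext w
  constructor
  · rintro ⟨⟨b, hb, rfl⟩, -, h⟩
    exact ⟨b, by simpa [hb] using h, rfl⟩
  · rintro ⟨b, hb, rfl⟩
    rw [Finset.mem_filter] at hb
    exact ⟨⟨b, hb.2.1, rfl⟩, by simp, by simpa using hb.2.2⟩

theorem reg_singleton_letter (b : B) : Reg ψ {[b]} := (GoodLang.letter b).reg

theorem reg_nil : Reg ψ {[]} := by
  intro s
  convert GoodLang.empty s using 1
  rw [Set.eq_empty_iff_forall_notMem]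
  rintro w ⟨rfl, h, -⟩
  exact h rfl

theorem ucat_of_length {L M : Set (List B)} {n : ℕ} (hL : ∀ u ∈ L, u.length = n) : UCat L M :=
  fun _ _ _ _ hu _ hu' _ h => List.append_inj h ((hL _ hu).trans (hL _ hu').symm)

theorem ucatS_of_length {L : Set (List B)} {X : Set (Stream' B)} {n : ℕ}
    (hL : ∀ u ∈ L, u.length = n) : UCatS L X := by
  rintro u x u' x' hu - hu' - h
  obtain rfl := Stream'.append_left_injective _ _ _ _ h ((hL _ hu).trans (hL _ hu').symm)
  exact ⟨rfl, Stream'.append_right_injective _ _ _ h⟩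

theorem starL_eq_subL {K : Set (List B)} {Z : Set S} (hZ : ∀ k ∈ K, val ψ k ∈ Z) :
    starL K = subL ψ K (words Z) := by
  ext w
  constructor
  · rintro ⟨l, hl, rfl⟩
    exact ⟨l, hl, List.forall_mem_map.mpr fun k hk => hZ k (hl k hk), rfl⟩
  · rintro ⟨l, hl, -, rfl⟩
    exact ⟨l, hl, rfl⟩

theorem omegaL_eq_subS {K : Set (List B)} {Z : Set S} (hZ : ∀ k ∈ K, val ψ k ∈ Z) :
    omegaL K = subS ψ K (infWords Z) := by
  ext x
  constructor
  · rintro ⟨g, hg, hx⟩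
    exact ⟨g, hg, fun n => hZ _ (hg n), hx⟩
  · rintro ⟨g, hg, -, hx⟩
    exact ⟨g, hg, hx⟩

namespace Sync

variable [Fintype S] {H : Set B} {K L : Set (List B)}

theorem reg_catL (hs : Sync H K) (hH : ∀ k ∈ K, HeadIn H k) (hK : Reg ψ (starL K))
    (hL : Reg ψ L) (hLs : Sync H L) {V : Set (List B)} (hV : Reg ψ V)
    (hVH : ∀ v ∈ V, HeadIn H v) (hno : ∀ k ∈ K, ∀ z, HeadIn H z → k ++ z ∉ V) :
    Reg ψ (catL L (catL (starL K) V)) := by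
  refine hL.cat (hK.cat hV (hs.ucat_star hH hVH hno)) (hLs.ucat ?_)
  rintro _ ⟨_, v, ⟨l, hl, rfl⟩, hv, rfl⟩
  exact headIn_flatten hH hl (hVH v hv)

theorem goodOmega_catS (hs : Sync H K) (hH : ∀ k ∈ K, HeadIn H k) (hne : [] ∉ K)
    (hK : Reg ψ (starL K)) (hKo : GoodOmega ψ (omegaL K))
    (hL : Reg ψ L) (hLs : Sync H L) {V : Set (Stream' B)} (hV : GoodOmega ψ V)
    (hVH : ∀ v ∈ V, v.head ∈ H) (hno : ∀ k ∈ K, ∀ z : Stream' B, z.head ∈ H → k ++ₛ z ∉ V) :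
    GoodOmega ψ (catS L (omegaL K ∪ catS (starL K) V)) := by
  refine hL.catS (hKo.union (hK.catS hV (hs.ucatS_star hH hVH hno))
    (hs.omegaL_inter_catS hH hne hVH hno)) (hLs.ucatS ?_)
  rintro x (hx | ⟨_, v, ⟨l, hl, rfl⟩, hv, rfl⟩)
  · exact head_mem_of_mem_omegaL hH hne hx
  · exact head_flatten_append hH hl (hVH v hv)

end Sync

section Marker

variable {D : Set B} {c : B}

theorem words_append {u v : List B} : u ++ v ∈ words D ↔ u ∈ words D ∧ v ∈ words D :=
  List.forall_mem_append

theorem infWords_append {u : List B} {x : Stream' B} :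
    u ++ₛ x ∈ infWords D ↔ u ∈ words D ∧ x ∈ infWords D :=
  forall_get_append

theorem words_mono {D' : Set B} (h : D' ⊆ D) : words D' ⊆ words D :=
  fun _ hw b hb => h (hw b hb)

theorem infWords_mono {D' : Set B} (h : D' ⊆ D) : infWords D' ⊆ infWords D :=
  fun _ hx n => h (hx n)

theorem exists_split_at {w : List B} (hw : w ∈ words D) :
    ∃ u ∈ words (D \ {c}), ∃ z ∈ words D, HeadIn {c} z ∧ w = u ++ z := by
  induction w with
  | nil => exact ⟨[], by simp [words], [], by simp [words], by simp [HeadIn], rfl⟩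
  | cons a w ih =>
    by_cases ha : a = c
    · subst ha
      refine ⟨[], by simp [words], _, hw, ?_, rfl⟩
      rintro b t h
      exact (List.cons.inj h).1.symm
    · obtain ⟨h1, h2⟩ := List.forall_mem_cons.mp hw
      obtain ⟨u, hu, z, hz, hc, rfl⟩ := ih h2
      exact ⟨a :: u, List.forall_mem_cons.mpr ⟨⟨h1, ha⟩, hu⟩, z, hz, hc, rfl⟩

theorem exists_split_at_stream {x : Stream' B} (hx : x ∈ infWords D) :
    x ∈ infWords (D \ {c}) ∨
      ∃ u ∈ words (D \ {c}), ∃ z ∈ infWords D, z.head ∈ ({c} : Set B) ∧ x = u ++ₛ z := by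
  classical
  by_cases h : ∃ n, x.get n = c
  · right
    refine ⟨x.take (Nat.find h), ?_, x.drop (Nat.find h), fun n => ?_, ?_,
      (Stream'.append_take_drop _ _).symm⟩
    · intro b hb
      obtain ⟨i, hi, rfl⟩ := List.getElem_of_mem hb
      rw [Stream'.length_take] at hi
      rw [Stream'.take_get]
      exact ⟨hx i, Nat.find_min h hi⟩
    · rw [Stream'.get_drop]
      exact hx _
    · change (x.drop (Nat.find h)).get 0 = c
      rw [Stream'.get_drop, Nat.add_zero]
      exact Nat.find_spec h
  · exact Or.inl fun n => ⟨hx n, fun e => h ⟨n, e⟩⟩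

/-- Words over `D` with one occurrence of `c` among all letters but the second, at the
beginning. -/
def blocks (D : Set B) (c : B) : Set (List B) :=
  catL (catL {[c]} (letters D)) (words (D \ {c}))

theorem mem_blocks {w : List B} :
    w ∈ blocks D c ↔ ∃ a ∈ D, ∃ y ∈ words (D \ {c}), w = c :: a :: y := by
  constructor
  · rintro ⟨_, y, ⟨_, _, rfl, ⟨a, ha, rfl⟩, rfl⟩, hy, rfl⟩
    exact ⟨a, ha, y, hy, rfl⟩
  · rintro ⟨a, ha, y, hy, rfl⟩
    exact ⟨[c, a], y, ⟨[c], [a], rfl, ⟨a, ha, rfl⟩, rfl⟩, hy, rfl⟩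

theorem sync_words : Sync {c} (words (D \ {c})) := by
  intro u b t _ h
  exact (h b (by simp)).2

theorem sync_blocks : Sync {c} (blocks D c) := by
  intro u b t hu h
  obtain ⟨a, -, y, -, rfl⟩ := mem_blocks.mp hu
  obtain ⟨a', -, y', hy', e⟩ := mem_blocks.mp h
  simp only [List.cons_append, List.cons.injEq, true_and] at e
  obtain ⟨-, rfl⟩ := e
  exact (hy' b (by simp)).2

theorem headIn_blocks : ∀ k ∈ blocks D c, HeadIn {c} k := by
  intro k hk b t e
  obtain ⟨a, -, y, -, rfl⟩ := mem_blocks.mp hk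
  exact (List.cons.inj e).1.symm

theorem nil_notMem_blocks : [] ∉ blocks D c := by
  intro h
  obtain ⟨a, -, y, -, e⟩ := mem_blocks.mp h
  simp at e

theorem length_of_mem_catL_letters : ∀ u ∈ catL {[c]} (letters D), u.length = 2 := by
  rintro _ ⟨_, _, rfl, ⟨a, -, rfl⟩, rfl⟩
  rfl

theorem words_eq_of_mem (hc : c ∈ D) :
    words D = catL (words (D \ {c})) (catL (starL (blocks D c)) ({[]} ∪ {[c]})) := by
  have hbl : ∀ k ∈ blocks D c, k ∈ words D := by
    intro k hk
    obtain ⟨a, ha, y, hy, rfl⟩ := mem_blocks.mp hk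
    exact List.forall_mem_cons.mpr ⟨hc, List.forall_mem_cons.mpr
      ⟨ha, words_mono Set.sdiff_subset hy⟩⟩
  ext w
  constructor
  · intro hw
    obtain ⟨u, hu, z, hz, hzc, rfl⟩ := exists_split_at (c := c) hw
    refine ⟨u, z, hu, ?_, rfl⟩
    refine mem_catL_star nil_notMem_blocks (fun z => z ∈ words D ∧ HeadIn {c} z) ?_ ⟨hz, hzc⟩
    rintro z ⟨hz, hzc⟩
    rcases z with _ | ⟨b, _ | ⟨a, z⟩⟩
    · exact Or.inl (Or.inl rfl)
    · obtain rfl := hzc b [] rfl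
      exact Or.inl (Or.inr rfl)
    · obtain rfl := hzc b _ rfl
      simp only [words, Set.mem_ofPred_eq, List.forall_mem_cons] at hz
      obtain ⟨u, hu, z, hz', hzc', rfl⟩ := exists_split_at (c := b) hz.2.2
      exact Or.inr ⟨_, mem_blocks.mpr ⟨a, hz.2.1, u, hu, rfl⟩, z, by simp, hz', hzc'⟩
  · rintro ⟨u, _, hu, ⟨_, v, ⟨l, hl, rfl⟩, hv, rfl⟩, rfl⟩
    refine words_append.mpr ⟨words_mono Set.sdiff_subset hu, words_append.mpr ⟨?_, ?_⟩⟩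
    · intro b hb
      obtain ⟨k, hk, hbk⟩ := List.mem_flatten.mp hb
      exact hbl k (hl k hk) b hbk
    · rcases hv with rfl | rfl <;> simp [words, hc]

theorem infWords_eq_of_mem (hc : c ∈ D) :
    infWords D = infWords (D \ {c}) ∪ catS (words (D \ {c})) (omegaL (blocks D c) ∪
      catS (starL (blocks D c)) (catS (catL {[c]} (letters D)) (infWords (D \ {c})))) := by
  have hbl : ∀ k ∈ blocks D c, k ∈ words D := by
    intro k hk
    obtain ⟨a, ha, y, hy, rfl⟩ := mem_blocks.mp hk
    exact List.forall_mem_cons.mpr ⟨hc, List.forall_mem_cons.mpr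
      ⟨ha, words_mono Set.sdiff_subset hy⟩⟩
  ext x
  constructor
  · intro hx
    rcases exists_split_at_stream (c := c) hx with hx | ⟨u, hu, z, hz, hzc, rfl⟩
    · exact Or.inl hx
    refine Or.inr ⟨u, z, hu, ?_, rfl⟩
    refine mem_omegaL_or_catS (fun z => z ∈ infWords D ∧ z.head ∈ ({c} : Set B)) ?_ ⟨hz, hzc⟩
    rintro z ⟨hz, hzc⟩
    have e : z = [c, z.get 1] ++ₛ z.drop 2 := by
      conv_lhs => rw [← Stream'.append_take_drop 2 z]
      congr 1
      obtain rfl : z.get 0 = c := hzc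
      rfl
    generalize z.get 1 = a, z.drop 2 = y at e
    subst e
    obtain ⟨h1, h2⟩ := infWords_append.mp hz
    have ha : a ∈ D := h1 a (by simp)
    rcases exists_split_at_stream (c := c) h2 with hx | ⟨u, hu, z, hz', hzc', rfl⟩
    · exact Or.inl ⟨_, _, ⟨[c], [a], rfl, ⟨a, ha, rfl⟩, rfl⟩, hx, rfl⟩
    · refine Or.inr ⟨_, mem_blocks.mpr ⟨a, ha, u, hu, rfl⟩, z, ?_, hz', hzc'⟩
      rw [← Stream'.append_append_stream]
      rfl
  · rintro (hx | ⟨u, _, hu, hx | ⟨_, _, ⟨l, hl, rfl⟩, ⟨_, v, ⟨_, _, rfl, ⟨a, ha, rfl⟩, rfl⟩,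
      hv, rfl⟩, rfl⟩, rfl⟩)
    · exact infWords_mono Set.sdiff_subset hx
    · refine infWords_append.mpr ⟨words_mono Set.sdiff_subset hu, ?_⟩
      obtain ⟨g, hg, hx⟩ := hx
      exact hx.forall_get (fun n h => nil_notMem_blocks (h ▸ hg n)) fun n => hbl _ (hg n)
    · refine infWords_append.mpr ⟨words_mono Set.sdiff_subset hu, infWords_append.mpr ⟨?_,
        infWords_append.mpr ⟨?_, infWords_mono Set.sdiff_subset hv⟩⟩⟩
      · intro b hb
        obtain ⟨k, hk, hbk⟩ := List.mem_flatten.mp hb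
        exact hbl k (hl k hk) b hbk
      · simp [words, hc, ha]

/-- Reduction to the words without `c` and to the words over the values of the blocks. -/
theorem good_of_blocks [Fintype B] [Fintype S] (hc : c ∈ D) {Z : Set S}
    (hZ : ∀ k ∈ blocks D c, val ψ k ∈ Z)
    (h1 : Reg ψ (words (D \ {c}))) (h2 : GoodOmega ψ (infWords (D \ {c})))
    (h3 : Reg id (words Z)) (h4 : GoodOmega id (infWords Z)) :
    Reg ψ (words D) ∧ GoodOmega ψ (infWords D) := by
  have hcode : Code (blocks D c) := sync_blocks.code headIn_blocks nil_notMem_blocks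
  have hocode : OCode (blocks D c) := sync_blocks.ocode headIn_blocks nil_notMem_blocks
  have hpre : Reg ψ (catL {[c]} (letters D)) :=
    (reg_singleton_letter c).cat (reg_letters D) (ucat_of_length (n := 1) (by simp))
  have hK : Reg ψ (blocks D c) := hpre.cat h1 (ucat_of_length length_of_mem_catL_letters)
  have hstar : Reg ψ (starL (blocks D c)) := by
    rw [starL_eq_subL hZ]
    exact hK.sub nil_notMem_blocks hcode h3
  have homega : GoodOmega ψ (omegaL (blocks D c)) := by
    rw [omegaL_eq_subS hZ]
    exact h4.sub hK nil_notMem_blocks hcode hocode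
  constructor
  · rw [words_eq_of_mem hc]
    refine sync_blocks.reg_catL headIn_blocks hstar h1 sync_words
      (reg_nil.union (reg_singleton_letter c) (by ext; simp)) ?_ ?_
    · rintro v (rfl | rfl) b t e
      · cases e
      · exact (List.cons.inj e).1.symm
    · rintro k hk z - h
      obtain ⟨a, -, y, -, rfl⟩ := mem_blocks.mp hk
      simp at h
  · rw [infWords_eq_of_mem hc]
    refine h2.union (sync_blocks.goodOmega_catS headIn_blocks nil_notMem_blocks hstar homega h1
      sync_words (hpre.catS h2 (ucatS_of_length length_of_mem_catL_letters)) ?_ ?_) ?_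
    · rintro _ ⟨_, v, ⟨_, _, rfl, ⟨a, ha, rfl⟩, rfl⟩, hv, rfl⟩
      rfl
    · rintro k hk z hz ⟨u, v, hu, hv, e⟩
      obtain ⟨a, -, y, -, rfl⟩ := mem_blocks.mp hk
      have e' : [c, a] ++ₛ (y ++ₛ z) = u ++ₛ v := by
        rw [← e, ← Stream'.append_append_stream]
        rfl
      obtain rfl := Stream'.append_left_injective _ _ _ _ e' (length_of_mem_catL_letters u hu).symm
      obtain rfl := Stream'.append_right_injective _ _ _ e'
      exact ((infWords_append.mp hv).2 0).2 hz
    · rw [Set.eq_empty_iff_forall_notMem]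
      rintro _ ⟨hx, u, y, hu, hy, rfl⟩
      have hh : y.head ∈ ({c} : Set B) := by
        rcases hy with hy | ⟨_, _, ⟨l, hl, rfl⟩, ⟨_, v, ⟨_, _, rfl, ⟨a, ha, rfl⟩, rfl⟩, hv, rfl⟩,
          rfl⟩
        · exact head_mem_of_mem_omegaL headIn_blocks nil_notMem_blocks hy
        · exact head_flatten_append headIn_blocks hl rfl
      exact ((infWords_append.mp hx).2 0).2 hh

end Marker

section Cayley

variable {D Q : Set S}

/-- Reading the word from `p` in the right Cayley graph uses letters of `D` only, and stays in `Q`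
after each letter. -/
def Run (D Q : Set S) : S → List S → Prop
  | _, [] => True
  | p, b :: w => b ∈ D ∧ p * b ∈ Q ∧ Run D Q (p * b) w

/-- The infinite version of `Run`. -/
def InfRun (D Q : Set S) (p : S) (x : Stream' S) : Prop := ∀ n, Run D Q p (x.take n)

theorem run_append {p : S} {u v : List S} :
    Run D Q p (u ++ v) ↔ Run D Q p u ∧ Run D Q (p * val id u) v := by
  induction u generalizing p with
  | nil => simp [Run]
  | cons b u ih => simp [Run, ih, and_assoc, mul_assoc]

theorem infRun_append {p : S} {u : List S} {x : Stream' S} :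
    InfRun D Q p (u ++ₛ x) ↔ Run D Q p u ∧ InfRun D Q (p * val id u) x := by
  constructor
  · intro h
    have h' := fun n => run_append.mp (Stream'.append_take n u x ▸ h (u.length + n))
    exact ⟨(h' 0).1, fun n => (h' n).2⟩
  · rintro ⟨h1, h2⟩ n
    obtain ⟨t, ht⟩ : (u ++ₛ x).take n <+: (u ++ₛ x).take (u.length + n) :=
      Stream'.take_prefix_take_left _ _ _ (Nat.le_add_left _ _)
    have h : Run D Q p ((u ++ₛ x).take (u.length + n)) :=
      Stream'.append_take _ _ _ ▸ run_append.mpr ⟨h1, h2 n⟩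
    rw [← ht] at h
    exact (run_append.mp h).1

theorem Run.mono {Q' : Set S} (hQ : Q ⊆ Q') {p : S} {w : List S} (h : Run D Q p w) :
    Run D Q' p w := by
  induction w generalizing p with
  | nil => trivial
  | cons b w ih => exact ⟨h.1, hQ h.2.1, ih h.2.2⟩

/-- The words read from `p` whose first visit outside of `Q` occurs at the end, in `q`. -/
def firstVisit (D Q : Set S) (q p : S) : Set (List S) :=
  {w | w ∈ catL {u | Run D Q p u} (letters D) ∧ val id w ∈ {s | p * s = q}}

section FirstVisit

variable {p q : S}

theorem run_of_mem_firstVisit {k : List S} (hk : k ∈ firstVisit D Q q p) :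
    Run D (insert q Q) p k ∧ p * val id k = q := by
  obtain ⟨⟨u, _, hu, ⟨b, hb, rfl⟩, rfl⟩, h⟩ := hk
  have h' : p * val id (u ++ [b]) = q := h
  refine ⟨run_append.mpr ⟨Run.mono (Set.subset_insert _ _) hu, hb, Or.inl ?_, trivial⟩, h'⟩
  simpa [mul_assoc] using h'

theorem not_run_firstVisit_append (hq : q ∉ Q) {k z : List S} (hk : k ∈ firstVisit D Q q p) :
    ¬ Run D Q p (k ++ z) := by
  intro h
  obtain ⟨⟨u, _, hu, ⟨b, hb, rfl⟩, rfl⟩, h'⟩ := hk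
  have h' : p * val id (u ++ [b]) = q := h'
  have h1 := (run_append.mp (run_append.mp h).1).2.2.1
  rw [mul_assoc] at h1
  refine hq ?_
  simpa [← h'] using h1

theorem sync_firstVisit (hq : q ∉ Q) : Sync Set.univ (firstVisit D Q q p) := by
  rintro k b t hk ⟨⟨u, _, hu, ⟨c, hc, rfl⟩, e⟩, -⟩ -
  have e1 := congrArg List.dropLast e
  rw [List.dropLast_concat, List.dropLast_append_of_ne_nil (by simp)] at e1
  exact not_run_firstVisit_append hq hk (e1 ▸ hu)

theorem nil_notMem_firstVisit : [] ∉ firstVisit D Q q p := by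
  rintro ⟨⟨u, _, hu, ⟨b, hb, rfl⟩, e⟩, -⟩
  simp at e

theorem run_insert_iff {w : List S} :
    Run D (insert q Q) p w ↔
      Run D Q p w ∨ ∃ k ∈ firstVisit D Q q p, ∃ z, w = k ++ z ∧ Run D (insert q Q) q z := by
  constructor
  · intro h
    induction w generalizing p with
    | nil => exact Or.inl trivial
    | cons b w ih =>
      obtain ⟨hb, hpb | hpb, hw⟩ := h
      · refine Or.inr ⟨[b], ⟨⟨[], [b], trivial, ⟨b, hb, rfl⟩, rfl⟩, by simpa using hpb⟩, w, rfl, ?_⟩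
        rwa [hpb] at hw
      · rcases ih hw with h | ⟨_, ⟨⟨u, v, hu, hv, rfl⟩, hk⟩, z, rfl, hz⟩
        · exact Or.inl ⟨hb, hpb, h⟩
        · refine Or.inr ⟨_, ⟨⟨b :: u, v, ⟨hb, hpb, hu⟩, hv, rfl⟩, ?_⟩, z, rfl, hz⟩
          simpa [mul_assoc] using hk
  · rintro (h | ⟨k, hk, z, rfl, hz⟩)
    · exact h.mono (Set.subset_insert _ _)
    · obtain ⟨h1, h2⟩ := run_of_mem_firstVisit hk
      exact run_append.mpr ⟨h1, h2.symm ▸ hz⟩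

theorem infRun_insert_iff {x : Stream' S} :
    InfRun D (insert q Q) p x ↔
      InfRun D Q p x ∨
        ∃ k ∈ firstVisit D Q q p, ∃ z, x = k ++ₛ z ∧ InfRun D (insert q Q) q z := by
  constructor
  · intro h
    by_cases h' : InfRun D Q p x
    · exact Or.inl h'
    · obtain ⟨n, hn⟩ := not_forall.mp h'
      rcases run_insert_iff.mp (h n) with h1 | ⟨k, hk, z, hz, -⟩
      · exact absurd h1 hn
      have e : x = k ++ₛ (z ++ₛ x.drop n) := by
        rw [← Stream'.append_append_stream, ← hz, Stream'.append_take_drop]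
      refine Or.inr ⟨k, hk, _, e, ?_⟩
      rw [e] at h
      exact (run_of_mem_firstVisit hk).2 ▸ (infRun_append.mp h).2
  · rintro (h | ⟨k, hk, z, rfl, hz⟩)
    · exact fun n => (h n).mono (Set.subset_insert _ _)
    · obtain ⟨h1, h2⟩ := run_of_mem_firstVisit hk
      exact infRun_append.mpr ⟨h1, h2.symm ▸ hz⟩

theorem run_insert_eq : {w | Run D (insert q Q) p w} = {w | Run D Q p w} ∪
    catL (firstVisit D Q q p) (catL (starL (firstVisit D Q q q)) {w | Run D Q q w}) := by
  ext w
  refine run_insert_iff.trans (or_congr Iff.rfl ?_)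
  constructor
  · rintro ⟨k, hk, z, rfl, hz⟩
    exact ⟨k, z, hk, mem_catL_star nil_notMem_firstVisit (Run D (insert q Q) q)
      (fun _ => run_insert_iff.mp) hz, rfl⟩
  · rintro ⟨k, _, hk, ⟨_, v, ⟨l, hl, rfl⟩, hv, rfl⟩, rfl⟩
    refine ⟨k, hk, _, rfl, ?_⟩
    induction l with
    | nil => exact Run.mono (Set.subset_insert _ _) hv
    | cons a l ih =>
      rw [List.forall_mem_cons] at hl
      rw [List.flatten_cons, List.append_assoc]
      exact run_insert_iff.mpr (Or.inr ⟨a, hl.1, _, rfl, ih hl.2⟩)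

theorem infRun_of_mem_omegaL {x : Stream' S} (hx : x ∈ omegaL (firstVisit D Q q q)) :
    InfRun D (insert q Q) q x := by
  intro n
  induction n using Nat.strong_induction_on generalizing x with
  | _ n ih =>
    obtain ⟨k, hk, y, hy, rfl⟩ := omegaL_step hx
    have hlen := List.length_pos_of_ne_nil (ne_of_mem_of_not_mem hk nil_notMem_firstVisit)
    obtain ⟨h1, h2⟩ := run_of_mem_firstVisit hk
    by_cases hn : n ≤ k.length
    · rw [Stream'.take_append_of_le_length _ _ _ hn]
      rw [← List.take_append_drop n k] at h1
      exact (run_append.mp h1).1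
    · obtain ⟨j, rfl⟩ := Nat.exists_eq_add_of_le (not_le.mp hn).le
      have h3 : Run D (insert q Q) q (k ++ y.take j) :=
        run_append.mpr ⟨h1, h2.symm ▸ ih j (by omega) hy⟩
      rwa [Stream'.append_take] at h3

theorem infRun_insert_eq : {x | InfRun D (insert q Q) p x} = {x | InfRun D Q p x} ∪
    catS (firstVisit D Q q p) (omegaL (firstVisit D Q q q) ∪
      catS (starL (firstVisit D Q q q)) {x | InfRun D Q q x}) := by
  ext w
  refine infRun_insert_iff.trans (or_congr Iff.rfl ?_)
  constructor
  · rintro ⟨k, hk, z, rfl, hz⟩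
    exact ⟨k, z, hk, mem_omegaL_or_catS (InfRun D (insert q Q) q)
      (fun _ => infRun_insert_iff.mp) hz, rfl⟩
  · rintro ⟨k, z, hk, hz | ⟨_, v, ⟨l, hl, rfl⟩, hv, rfl⟩, rfl⟩
    · exact ⟨k, hk, z, rfl, infRun_of_mem_omegaL hz⟩
    refine ⟨k, hk, _, rfl, ?_⟩
    induction l with
    | nil => exact infRun_insert_iff.mpr (Or.inl hv)
    | cons a l ih =>
      rw [List.forall_mem_cons] at hl
      rw [List.flatten_cons, Stream'.append_append_stream]
      exact infRun_insert_iff.mpr (Or.inr ⟨a, hl.1, _, rfl, ih hl.2⟩)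

end FirstVisit

theorem run_iff_words {p : S} {w : List S} (hp : ∀ b ∈ D, p * b ∈ Q)
    (hQ : ∀ a ∈ Q, ∀ b ∈ D, a * b ∈ Q) : Run D Q p w ↔ w ∈ words D := by
  induction w generalizing p with
  | nil => simp [Run, words]
  | cons b w ih =>
    have hw : b :: w ∈ words D ↔ b ∈ D ∧ w ∈ words D := List.forall_mem_cons
    rw [hw]
    refine and_congr_right fun hb => ?_
    rw [and_iff_right (hp b hb), ih (hQ _ (hp b hb))]

theorem val_mem_of_mul_closed {T : Set S} (hT : ∀ a ∈ T, ∀ b ∈ T, a * b ∈ T) {w : List S}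
    (hw : w ∈ words T) (hne : w ≠ []) : val id w ∈ T := by
  induction w with
  | nil => exact absurd rfl hne
  | cons b w ih =>
    obtain ⟨hb, hw⟩ := List.forall_mem_cons.mp hw
    rw [val_cons]
    by_cases h : w = []
    · simpa [h] using hb
    · exact hT _ hb _ (ih hw h)

theorem Run.mem_words {p : S} {w : List S} (h : Run D Q p w) : w ∈ words D := by
  induction w generalizing p with
  | nil => simp [words]
  | cons b w ih => exact List.forall_mem_cons.mpr ⟨h.1, ih h.2.2⟩

variable [Fintype S]

theorem reg_firstVisit {p q : S} (h : Reg id {w | Run D Q p w}) :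
    Reg id (firstVisit D Q q p) := by
  refine (h.cat (reg_letters D) ?_).restrict _
  rintro u _ u' _ - ⟨b, -, rfl⟩ - ⟨b', -, rfl⟩ e
  exact List.append_inj' e rfl

theorem good_run_insert {T : Set S} (hT : ∀ a ∈ T, ∀ b ∈ T, a * b ∈ T) (hD : D ⊆ T) {q : S}
    (hq : q ∉ Q) (hinj : Set.InjOn (q * ·) T)
    (h : ∀ p, Reg id {w | Run D Q p w} ∧ GoodOmega id {x | InfRun D Q p x}) (p : S) :
    Reg id {w | Run D (insert q Q) p w} ∧ GoodOmega id {x | InfRun D (insert q Q) p x} := by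
  have hs : Sync Set.univ (firstVisit D Q q q) := sync_firstVisit hq
  have hH : ∀ k ∈ firstVisit D Q q q, HeadIn Set.univ k := fun _ _ _ _ _ => trivial
  have hne : [] ∉ firstVisit D Q q q := nil_notMem_firstVisit
  have hval : ∀ k ∈ firstVisit D Q q q, val id k ∈ T ∧ q * val id k = q := by
    intro k hk
    obtain ⟨h1, h2⟩ := run_of_mem_firstVisit hk
    exact ⟨val_mem_of_mul_closed hT (words_mono hD h1.mem_words) (ne_of_mem_of_not_mem hk hne), h2⟩
  obtain ⟨e, he, hKe⟩ : ∃ e : S, e * e = e ∧ ∀ k ∈ firstVisit D Q q q, val id k = e := by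
    by_cases hK : ∃ k, k ∈ firstVisit D Q q q
    · obtain ⟨k, hk⟩ := hK
      obtain ⟨h1, h2⟩ := hval k hk
      refine ⟨val id k, hinj (hT _ h1 _ h1) h1 ?_, fun k' hk' => ?_⟩
      · simp only [← mul_assoc, h2]
      · obtain ⟨h1', h2'⟩ := hval k' hk'
        exact hinj h1' h1 (h2'.trans h2.symm)
    · exact ⟨1, one_mul 1, fun k hk => (hK ⟨k, hk⟩).elim⟩
  have hK : GoodLang id (firstVisit D Q q q) e := (reg_firstVisit (h q).1).goodLang hne hKe
  have hstar : Reg id (starL (firstVisit D Q q q)) := by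
    refine (hK.plus he (hs.code hH hne)).reg.congr fun w hw => ?_
    constructor
    · rintro ⟨l, -, hl, rfl⟩
      exact ⟨l, hl, rfl⟩
    · rintro ⟨l, hl, rfl⟩
      exact ⟨l, fun e => hw (by rw [e]; rfl), hl, rfl⟩
  have homega : GoodOmega id (omegaL (firstVisit D Q q q)) := by
    rw [omegaL_eq_catS]
    exact GoodOmega.base hK hK he (hs.ucatS fun _ _ => trivial) (hs.ocode hH hne)
  constructor
  · rw [run_insert_eq]
    refine (h p).1.union (hs.reg_catL hH hstar (reg_firstVisit (h p).1) (sync_firstVisit hq)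
      (h q).1 (fun _ _ _ _ _ => trivial) fun k hk z _ => not_run_firstVisit_append hq hk) ?_
    rw [Set.eq_empty_iff_forall_notMem]
    rintro _ ⟨hw, u, v, hu, -, rfl⟩
    exact not_run_firstVisit_append hq hu hw
  · have hno : ∀ p, ∀ k ∈ firstVisit D Q q p, ∀ z : Stream' S, ¬ InfRun D Q p (k ++ₛ z) := by
      intro p k hk z hz
      refine not_run_firstVisit_append (z := []) hq hk ?_
      rw [List.append_nil]
      exact (infRun_append.mp hz).1
    rw [infRun_insert_eq]
    refine (h p).2.union (hs.goodOmega_catS hH hne hstar homega (reg_firstVisit (h p).1)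
      (sync_firstVisit hq) (h q).2 (fun _ _ => trivial) fun k hk z _ => hno q k hk z) ?_
    rw [Set.eq_empty_iff_forall_notMem]
    rintro _ ⟨hx, u, v, hu, -, rfl⟩
    exact hno p u hu v hx

theorem good_run {T : Set S} (hT : ∀ a ∈ T, ∀ b ∈ T, a * b ∈ T) (hD : D ⊆ T)
    (hQ : ∀ q ∈ Q, Set.InjOn (q * ·) T) (p : S) :
    Reg id {w | Run D Q p w} ∧ GoodOmega id {x | InfRun D Q p x} := by
  induction Q, Set.toFinite Q using Set.Finite.induction_on generalizing p with
  | empty =>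
    constructor
    · refine reg_nil.congr fun w hw => iff_of_false hw fun h => ?_
      cases w with
      | nil => exact hw rfl
      | cons b w => exact h.2.1
    · convert GoodOmega.empty using 1
      rw [Set.eq_empty_iff_forall_notMem]
      exact fun x hx => (hx 1).2.1
  | insert hq _ ih =>
    rw [Set.forall_mem_insert] at hQ
    exact good_run_insert hT hD hq hQ.1 (ih hQ.2) p

/-- The words over a set of elements acting injectively. -/
theorem good_of_injOn {T : Set S} (hT : ∀ a ∈ T, ∀ b ∈ T, a * b ∈ T) (hD : D ⊆ T)
    (hinj : ∀ c ∈ D, Set.InjOn (c * ·) T) :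
    Reg id (words D) ∧ GoodOmega id (infWords D) := by
  have h := good_run (Q := {q | q ∈ T ∧ Set.InjOn (q * ·) T}) hT hD (fun q hq => hq.2) 1
  have hiff : ∀ w, Run D {q | q ∈ T ∧ Set.InjOn (q * ·) T} 1 w ↔ w ∈ words D := by
    refine fun w => run_iff_words (fun b hb => ?_) fun a ha b hb => ⟨hT _ ha.1 _ (hD hb), ?_⟩
    · rw [one_mul]
      exact ⟨hD hb, hinj b hb⟩
    · intro x hx y hy e
      refine hinj b hb hx hy (ha.2 (hT _ (hD hb) _ hx) (hT _ (hD hb) _ hy) ?_)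
      simpa only [mul_assoc] using e
  constructor
  · convert h.1 using 1
    ext w
    exact (hiff w).symm
  · convert h.2 using 1
    ext x
    refine ⟨fun hx n => (hiff _).mpr fun b hb => ?_, fun hx n => ?_⟩
    · obtain ⟨i, hi, rfl⟩ := List.getElem_of_mem hb
      rw [Stream'.take_get]
      exact hx i
    · have := (hiff _).mp (hx (n + 1))
      rw [Stream'.take_succ'] at this
      exact (words_append.mp this).2 _ (List.mem_singleton_self _)

theorem good_words (n : ℕ) (T D : Set S) (hT : ∀ a ∈ T, ∀ b ∈ T, a * b ∈ T) (hD : D ⊆ T)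
    (hn : T.ncard = n) : Reg id (words D) ∧ GoodOmega id (infWords D) := by
  induction n using Nat.strong_induction_on generalizing T D with
  | _ n ih =>
    induction hm : D.ncard using Nat.strong_induction_on generalizing D with
    | _ m ihD =>
      by_cases hinj : ∀ c ∈ D, Set.InjOn (c * ·) T
      · exact good_of_injOn hT hD hinj
      · push Not at hinj
        obtain ⟨c, hc, hcT⟩ := hinj
        have hlt : (Set.image (c * ·) T).ncard < n := by
          rw [← hn]
          refine lt_of_le_of_ne (Set.ncard_image_le (Set.toFinite T)) fun h => hcT ?_
          exact Set.injOn_of_ncard_image_eq h (Set.toFinite T)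
        have h1 := ihD _ (hm ▸ Set.ncard_sdiff_singleton_lt_of_mem hc (Set.toFinite D))
          (D \ {c}) (Set.sdiff_subset.trans hD) rfl
        have h2 := ih _ hlt (Set.image (c * ·) T) (Set.image (c * ·) T) ?_ subset_rfl rfl
        · refine good_of_blocks hc ?_ h1.1 h1.2 h2.1 h2.2
          intro k hk
          obtain ⟨a, ha, y, hy, rfl⟩ := mem_blocks.mp hk
          refine ⟨val id (a :: y), val_mem_of_mul_closed hT ?_ (by simp), rfl⟩
          exact List.forall_mem_cons.mpr
            ⟨hD ha, words_mono (Set.sdiff_subset.trans hD) hy⟩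
        · rintro _ ⟨a, ha, rfl⟩ _ ⟨b, hb, rfl⟩
          refine ⟨a * (c * b), hT _ ha _ (hT _ (hD hc) _ hb), ?_⟩
          simp only [mul_assoc]

end Cayley

section Expressions

variable {φ : List B → S}

theorem good_zero : (RE.zero : RE B).Good φ := by
  refine ⟨trivial, fun E hE => ?_, fun E hE => ?_⟩
  · cases hE
    exact ⟨1, fun w hw => hw.elim⟩
  · cases hE

theorem good_char (b : B) : (RE.char b).Good φ := by
  refine ⟨trivial, fun E hE => ?_, fun E hE => ?_⟩
  · cases hE
    exact ⟨φ [b], by rintro w rfl; rfl⟩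
  · cases hE

theorem good_union {e f : RE B} {s : S} (he : e.Good φ) (hf : f.Good φ)
    (h : e.lang ∩ f.lang = ∅) (hs : ∀ w ∈ (RE.union e f).lang, φ w = s) :
    (RE.union e f).Good φ := by
  refine ⟨⟨he.1, hf.1, h⟩, fun E hE => ?_, fun E hE => ?_⟩
  · cases hE with
    | refl => exact ⟨s, hs⟩
    | unionL hE => exact he.2.1 E hE
    | unionR hE => exact hf.2.1 E hE
  · cases hE with
    | unionL hE => exact he.2.2 E hE
    | unionR hE => exact hf.2.2 E hE

theorem good_cat {e f : RE B} {s : S} (he : e.Good φ) (hf : f.Good φ)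
    (h : UCat e.lang f.lang) (hs : ∀ w ∈ (RE.cat e f).lang, φ w = s) : (RE.cat e f).Good φ := by
  refine ⟨⟨he.1, hf.1, h⟩, fun E hE => ?_, fun E hE => ?_⟩
  · cases hE with
    | refl => exact ⟨s, hs⟩
    | catL hE => exact he.2.1 E hE
    | catR hE => exact hf.2.1 E hE
  · cases hE with
    | catL hE => exact he.2.2 E hE
    | catR hE => exact hf.2.2 E hE

theorem good_plus {e : RE B} {s t : S} (he : e.Good φ) (h : Code e.lang) (hs : s * s = s)
    (hes : ∀ w ∈ e.lang, φ w = s) (ht : ∀ w ∈ (RE.plus e).lang, φ w = t) :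
    (RE.plus e).Good φ := by
  refine ⟨⟨he.1, fun l l' _ _ => h l l'⟩, fun E hE => ?_, fun E hE => ?_⟩
  · cases hE with
    | refl => exact ⟨t, ht⟩
    | plus hE => exact he.2.1 E hE
  · cases hE with
    | refl => exact ⟨s, hs, hes⟩
    | plus hE => exact he.2.2 E hE

theorem GoodLang.exists_re {L : Set (List B)} {s : S} (h : GoodLang ψ L s) :
    ∃ E : RE B, E.epsFree ∧ E.Good (val ψ) ∧ E.lang = L := by
  induction h with
  | empty s => exact ⟨.zero, trivial, good_zero, rfl⟩
  | letter b => exact ⟨.char b, trivial, good_char b, rfl⟩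
  | union hL hM h ih1 ih2 =>
    obtain ⟨e, he, heg, rfl⟩ := ih1
    obtain ⟨f, hf, hfg, rfl⟩ := ih2
    exact ⟨.union e f, ⟨he, hf⟩, good_union heg hfg h (hL.union hM h).val_eq, rfl⟩
  | cat hL hM h ih1 ih2 =>
    obtain ⟨e, he, heg, rfl⟩ := ih1
    obtain ⟨f, hf, hfg, rfl⟩ := ih2
    exact ⟨.cat e f, ⟨he, hf⟩, good_cat heg hfg h (hL.cat hM h).val_eq, rfl⟩
  | plus hL hs h ih =>
    obtain ⟨e, he, heg, rfl⟩ := ih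
    exact ⟨.plus e, he, good_plus heg h hs hL.val_eq (hL.plus hs h).val_eq, rfl⟩

/-- `d` is a decomposition of `x` according to the `ω`-expression `⋃ i, F i · (G i)^ω`. -/
def IsDecomposition {ι : Type} (F G : ι → RE B) (x : Stream' B)
    (d : ι × List B × (ℕ → List B)) : Prop :=
  d.2.1 ∈ (F d.1).lang ∧ (∀ n, d.2.2 n ∈ (G d.1).lang) ∧ ∃ y, InfCat d.2.2 y ∧ x = d.2.1 ++ₛ y

/-- The `ω`-expression `⋃ i, F i · (G i)^ω` is good, unambiguous and denotes `X`. -/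
structure Represents {ι : Type} (φ : List B → S) (F G : ι → RE B) (X : Set (Stream' B)) :
    Prop where
  good : ∀ i, (F i).epsFree ∧ (F i).Good φ ∧ (G i).epsFree ∧ (G i).Good φ
  idem : ∀ i, ∃ s : S, s * s = s ∧ ∀ v ∈ (G i).lang, φ v = s
  existsUnique : ∀ x ∈ X, ∃! d, IsDecomposition F G x d
  mem : ∀ x d, IsDecomposition F G x d → x ∈ X

theorem Represents.sumElim {ι κ : Type} {F G : ι → RE B} {F' G' : κ → RE B}
    {X Y : Set (Stream' B)} (hX : Represents φ F G X) (hY : Represents φ F' G' Y)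
    (h : X ∩ Y = ∅) : Represents φ (Sum.elim F F') (Sum.elim G G') (X ∪ Y) where
  good := by
    rintro (i | i)
    exacts [hX.good i, hY.good i]
  idem := by
    rintro (i | i)
    exacts [hX.idem i, hY.idem i]
  existsUnique := by
    rw [Set.eq_empty_iff_forall_notMem] at h
    rintro x (hx | hx)
    · obtain ⟨d, hd, hu⟩ := hX.existsUnique x hx
      refine ⟨(Sum.inl d.1, d.2), hd, ?_⟩
      rintro ⟨i | i, r⟩ hr
      · rw [← hu (i, r) hr]
      · exact absurd ⟨hx, hY.mem x (i, r) hr⟩ (h x)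
    · obtain ⟨d, hd, hu⟩ := hY.existsUnique x hx
      refine ⟨(Sum.inr d.1, d.2), hd, ?_⟩
      rintro ⟨i | i, r⟩ hr
      · exact absurd ⟨hX.mem x (i, r) hr, hx⟩ (h x)
      · rw [← hu (i, r) hr]
  mem := by
    rintro x ⟨i | i, r⟩ hr
    exacts [Or.inl (hX.mem x (i, r) hr), Or.inr (hY.mem x (i, r) hr)]

theorem Represents.comp_equiv {ι κ : Type} {F G : ι → RE B} {X : Set (Stream' B)}
    (h : Represents φ F G X) (e : κ ≃ ι) : Represents φ (F ∘ e) (G ∘ e) X where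
  good i := h.good (e i)
  idem i := h.idem (e i)
  existsUnique x hx := by
    obtain ⟨d, hd, hu⟩ := h.existsUnique x hx
    refine ⟨(e.symm d.1, d.2), by simpa [IsDecomposition] using hd, ?_⟩
    rintro ⟨i, r⟩ hr
    rw [← hu (e i, r) hr, e.symm_apply_apply]
  mem x d hd := h.mem x (e d.1, d.2) hd

theorem GoodOmega.exists_represents {X : Set (Stream' B)} (h : GoodOmega ψ X) :
    ∃ (ι : Type) (_ : Fintype ι) (_ : Nonempty ι) (F G : ι → RE B),
      Represents (val ψ) F G X := by
  induction h with
  | empty =>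
    exact ⟨Unit, inferInstance, inferInstance, fun _ => .zero, fun _ => .zero,
      fun _ => ⟨trivial, good_zero, trivial, good_zero⟩,
      fun _ => ⟨1, one_mul 1, fun _ h => h.elim⟩, fun _ h => h.elim, fun _ _ h => h.1.elim⟩
  | base hF hG he h hc =>
    obtain ⟨E, hE, hEg, rfl⟩ := hF.exists_re
    obtain ⟨E', hE', hEg', rfl⟩ := hG.exists_re
    refine ⟨Unit, inferInstance, inferInstance, fun _ => E, fun _ => E',
      fun _ => ⟨hE, hEg, hE', hEg'⟩, fun _ => ⟨_, he, hG.val_eq⟩, ?_, ?_⟩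
    · rintro x ⟨u, y, hu, ⟨g, hg, hy⟩, rfl⟩
      refine ⟨((), u, g), ⟨hu, hg, y, hy, rfl⟩, ?_⟩
      rintro ⟨_, u', g'⟩ ⟨hu', hg', y', hy', e⟩
      obtain ⟨rfl, rfl⟩ := h _ _ _ _ hu ⟨g, hg, hy⟩ hu' ⟨g', hg', hy'⟩ e
      obtain rfl : g = g' := hc _ _ _ hg hg' hy hy'
      rfl
    · rintro x ⟨_, u, g⟩ ⟨hu, hg, y, hy, rfl⟩
      exact ⟨u, y, hu, ⟨g, hg, hy⟩, rfl⟩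
  | union _ _ h ih1 ih2 =>
    obtain ⟨ι, _, _, F, G, h1⟩ := ih1
    obtain ⟨κ, _, _, F', G', h2⟩ := ih2
    exact ⟨ι ⊕ κ, inferInstance, inferInstance, _, _, h1.sumElim h2 h⟩

end Expressions

theorem goodOmega_univ [Fintype B] [Fintype S] : GoodOmega ψ (Set.univ : Set (Stream' B)) := by
  have hne : [] ∉ letters (Set.univ : Set B) := by
    rintro ⟨b, -, h⟩
    cases h
  have hs : Sync Set.univ (letters (Set.univ : Set B)) := by
    rintro _ b t ⟨a, -, rfl⟩ ⟨a', -, h⟩ -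
    simp at h
  have hH : ∀ k ∈ letters (Set.univ : Set B), HeadIn Set.univ k := fun _ _ _ _ _ => trivial
  have huniv : omegaL (letters (Set.univ : Set B)) = Set.univ := by
    refine Set.eq_univ_of_forall fun x => ?_
    refine mem_omegaL_of_step (fun _ => True) (fun x _ => ?_) trivial
    exact ⟨[x.head], ⟨x.head, trivial, rfl⟩, x.tail, (Stream'.eta x).symm, trivial⟩
  rw [← huniv, omegaL_eq_subS (ψ := ψ) (Z := Set.univ) fun _ _ => trivial]
  exact GoodOmega.sub (reg_letters _) hne (hs.code hH hne) (hs.ocode hH hne)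
    (good_words _ Set.univ Set.univ (fun _ _ _ _ => trivial) subset_rfl rfl).2

theorem isPrefixOfInf_iff {u : List B} {w : Stream' B} :
    IsPrefixOfInf u w ↔ ∃ y, w = u ++ₛ y := by
  constructor
  · intro h
    refine ⟨w.drop u.length, ?_⟩
    have e : w.take u.length = u := by
      refine List.ext_getElem (Stream'.length_take _ _) fun i h1 h2 => ?_
      rw [Stream'.take_get]
      exact h ⟨i, h2⟩
    conv_lhs => rw [← Stream'.append_take_drop u.length w, e]
  · rintro ⟨y, rfl⟩ i
    exact Stream'.get_append_left _ _ _ i.2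

theorem forall_isPrefixOfInf_iff {u : List B} {v : ℕ → List B} {w : Stream' B} :
    (∀ n, IsPrefixOfInf (u ++ ((List.range n).map v).flatten) w) ↔
      ∃ y, InfCat v y ∧ w = u ++ₛ y := by
  have hsucc : ∀ n, ((List.range (n + 1)).map v).flatten =
      ((List.range n).map v).flatten ++ v n := fun n => by simp [List.range_succ]
  constructor
  · intro h
    choose W hW using fun n => isPrefixOfInf_iff.mp (h n)
    refine ⟨W 0, ⟨W, rfl, fun n => ?_⟩, by simpa using hW 0⟩
    have e := (hW n).symm.trans (hW (n + 1))
    rw [hsucc, ← List.append_assoc, Stream'.append_append_stream _ (v n)] at e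
    exact Stream'.append_right_injective _ _ _ e
  · rintro ⟨_, ⟨W, rfl, hW⟩, rfl⟩ n
    refine isPrefixOfInf_iff.mpr ⟨W n, ?_⟩
    rw [Stream'.append_append_stream]
    congr 1
    induction n with
    | zero => rfl
    | succ n ih =>
      rw [ih, hsucc, Stream'.append_append_stream]
      exact congrArg (_ ++ₛ ·) (hW n)

end OmegaRat

/-- **Unambiguous forest factorization, infinite words (T₂).**
For a morphism `φ : Σ* → S` to a finite monoid there are `m ≥ 1` and `ε`-free
`φ`-good rational expressions `F k`, `G k` (`1 ≤ k ≤ m`), each `L(G k)` mapped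
by `φ` into a single idempotent `s k`, such that the ω-expression
`⋃ₖ F k · (G k)^ω` is universal and unambiguous: every infinite word `w` has
exactly one decomposition `(k, u, v)` with `u ∈ L(F k)`, `v i ∈ L(G k)` for all
`i`, and `w = u v₀ v₁ v₂ ⋯`. -/
theorem unambiguous_forest_factorization_infinite
    {A S : Type} [Fintype A] [Monoid S] [Fintype S]
    (φ : List A → S) (hφ : ∀ u v : List A, φ (u ++ v) = φ u * φ v)
    (hφ1 : φ [] = 1) :
    ∃ (m : ℕ) (F G : Fin m → RE A), 1 ≤ m ∧
      (∀ k, (F k).epsFree ∧ (F k).Good φ ∧ (G k).epsFree ∧ (G k).Good φ) ∧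
      (∀ k, ∃ s : S, s * s = s ∧ ∀ v ∈ (G k).lang, φ v = s) ∧
      (∀ w : ℕ → A,
        ∃! d : Fin m × List A × (ℕ → List A),
          d.2.1 ∈ (F d.1).lang ∧ (∀ i, d.2.2 i ∈ (G d.1).lang) ∧
          ∀ n : ℕ,
            IsPrefixOfInf (d.2.1 ++ ((List.range n).map d.2.2).flatten) w) := by
  have hval : φ = OmegaRat.val fun a => φ [a] := by
    funext w
    induction w with
    | nil => exact hφ1
    | cons a w ih => rw [OmegaRat.val_cons, ← ih, ← hφ, List.singleton_append]
  obtain ⟨ι, _, _, F, G, h⟩ :=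
    (OmegaRat.goodOmega_univ (ψ := fun a : A => φ [a])).exists_represents
  rw [← hval] at h
  have h' := h.comp_equiv (Fintype.equivFin ι).symm
  refine ⟨_, _, _, Fintype.card_pos, h'.good, h'.idem, fun w => ?_⟩
  exact (existsUnique_congr fun d => and_congr_right fun _ => and_congr_right fun _ =>
    OmegaRat.forall_isPrefixOfInf_iff).mpr (h'.existsUnique w trivial)
end
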